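/- arXiv:1708.01317 — 5 statements merged into one kernel-verified Lean document; each statement's English description precedes it below -/
import Mathlib

section
/- For every pair of finite linear orders R and S with |R| < |S| and every r ∈ ℕ, there exists n > |S| such that for every r-coloring of the set Epi(n, R) of rigid surjections from {0,...,n−1} (with its natural order) onto R, there is a rigid surjection γ ∈ Epi(n, S) such that the set {σ ∘ γ : σ ∈ Epi(S, R)} is monochromatic. -/
/-- `f : α → β` between linear orders is a rigid surjection if it is surjective and
`min f⁻¹(s₀) < min f⁻¹(s₁)` whenever `s₀ < s₁` (expressed via: some element of `f⁻¹(s₀)`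
lies strictly below every element of `f⁻¹(s₁)`). -/
def IsRigidSurjection {α β : Type*} [LinearOrder α] [LinearOrder β] (f : α → β) : Prop :=
  Function.Surjective f ∧
    ∀ s₀ s₁ : β, s₀ < s₁ → ∃ a, f a = s₀ ∧ ∀ b, f b = s₁ → a < b

/-- Restricted growth words: `RestrictedGrowth a b w` says that `w` is a word over the letters
`0, …, b - 1` in which each of the letters `a, …, b - 1` occurs, and their first occurrences
come in increasing order. The letters below `a` form the constant alphabet, the remaining ones
are the parameters. -/
inductive RestrictedGrowth : ℕ → ℕ → List ℕ → Prop
  | nil (a : ℕ) : RestrictedGrowth a a []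
  | old {a b x : ℕ} {w : List ℕ} (hx : x < a) (hw : RestrictedGrowth a b w) :
      RestrictedGrowth a b (x :: w)
  | new {a b : ℕ} {w : List ℕ} (hw : RestrictedGrowth (a + 1) b w) :
      RestrictedGrowth a b (a :: w)

/-- The substitution replacing the parameter `a + i` by the `i`-th letter of `g`. -/
def paramSubst (a : ℕ) (g : List ℕ) (x : ℕ) : ℕ :=
  if x < a then x else g.getD (x - a) 0

/-- The map renaming the parameters `a, a + 1, …` to `a + 1, a + 2, …`. -/
def paramShift (a x : ℕ) : ℕ :=
  if x < a then x else x + 1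

/-- The part of a word that precedes its first parameter. -/
def constPrefix (a : ℕ) (w : List ℕ) : List ℕ :=
  w.takeWhile (· < a)

lemma paramSubst_of_lt {a x : ℕ} (g : List ℕ) (h : x < a) : paramSubst a g x = x := by
  simp [paramSubst, h]

lemma paramSubst_cons_self_param (a x : ℕ) (g : List ℕ) : paramSubst a (x :: g) a = x := by
  simp [paramSubst]

lemma paramSubst_cons_self (a : ℕ) (g : List ℕ) :
    paramSubst a (a :: g) = paramSubst (a + 1) g := by
  funext z
  unfold paramSubst
  rcases lt_trichotomy z a with h | rfl | h
  · simp [h, Nat.lt_succ_of_lt h]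
  · simp
  · obtain ⟨t, rfl⟩ : ∃ t, z = a + 1 + t := ⟨z - (a + 1), by omega⟩
    have h1 : a + 1 + t - a = t + 1 := by omega
    have h2 : ¬ a + 1 + t < a := by omega
    have h3 : ¬ a + 1 + t < a + 1 := by omega
    rw [if_neg h2, if_neg h3, h1, Nat.add_sub_cancel_left, List.getD_cons_succ]

lemma paramSubst_cons_paramShift (a x : ℕ) (g : List ℕ) (y : ℕ) :
    paramSubst a (x :: g) (paramShift a y) = paramSubst a g y := by
  unfold paramSubst paramShift
  by_cases h : y < a
  · simp [h]
  · have h1 : y + 1 - a = (y - a) + 1 := by omega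
    have h2 : ¬ y + 1 < a := by omega
    simp [h, h1, h2]

lemma map_paramSubst_eq_self {a : ℕ} {w : List ℕ} (g : List ℕ) (h : ∀ x ∈ w, x < a) :
    w.map (paramSubst a g) = w := by
  conv_rhs => rw [← List.map_id w]
  exact List.map_congr_left fun x hx => paramSubst_of_lt g (h x hx)

lemma map_paramSubst_range' (a : ℕ) (g : List ℕ) :
    (List.range' a g.length).map (paramSubst a g) = g := by
  apply List.ext_getElem
  · simp
  · intro i h1 h2
    simp [paramSubst, h2]

lemma map_cons_paramShift_map_paramSubst (a x : ℕ) (f g : List ℕ) :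
    (a :: f.map (paramShift a)).map (paramSubst a (x :: g)) = x :: f.map (paramSubst a g) := by
  simp [paramSubst_cons_self_param, paramSubst_cons_paramShift]

lemma constPrefix_cons_self (a : ℕ) (w : List ℕ) : constPrefix a (a :: w) = [] := by
  simp [constPrefix]

lemma constPrefix_cons_of_lt {a x : ℕ} (w : List ℕ) (h : x < a) :
    constPrefix a (x :: w) = x :: constPrefix a w := by
  simp [constPrefix, h]

lemma constPrefix_append_of_lt {a : ℕ} {u : List ℕ} (w : List ℕ) (h : ∀ x ∈ u, x < a) :
    constPrefix a (u ++ w) = u ++ constPrefix a w := by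
  simp only [constPrefix]
  exact List.takeWhile_append_of_pos (by simpa using h)

namespace RestrictedGrowth

lemma le {a b : ℕ} {w : List ℕ} (h : RestrictedGrowth a b w) : a ≤ b := by
  induction h with
  | nil => exact le_rfl
  | old _ _ ih => exact ih
  | new _ ih => omega

lemma lt_of_mem {a b : ℕ} {w : List ℕ} (h : RestrictedGrowth a b w) : ∀ x ∈ w, x < b := by
  induction h with
  | nil => simp
  | old hx hw ih =>
    have := hw.le
    intro y hy
    rcases List.mem_cons.1 hy with rfl | hy
    · omega
    · exact ih y hy
  | new hw ih =>
    have := hw.le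
    intro y hy
    rcases List.mem_cons.1 hy with rfl | hy
    · omega
    · exact ih y hy

lemma of_forall_lt {a : ℕ} {w : List ℕ} (h : ∀ x ∈ w, x < a) : RestrictedGrowth a a w := by
  induction w with
  | nil => exact nil a
  | cons x w ih =>
    exact old (h x (by simp)) (ih fun y hy => h y (by simp [hy]))

lemma append {a b c : ℕ} {u v : List ℕ} (hu : RestrictedGrowth a b u)
    (hv : RestrictedGrowth b c v) : RestrictedGrowth a c (u ++ v) := by
  induction hu with
  | nil => exact hv
  | old hx _ ih => exact old hx (ih hv)
  | new _ ih => exact new (ih hv)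

lemma range' (a m : ℕ) : RestrictedGrowth a (a + m) (List.range' a m) := by
  induction m generalizing a with
  | zero => exact nil a
  | succ m ih =>
    rw [List.range'_succ]
    have := ih (a + 1)
    rw [show a + 1 + m = a + (m + 1) by omega] at this
    exact new this

lemma map_of_range' {a b c d : ℕ} {w : List ℕ} (φ : ℕ → ℕ) (hw : RestrictedGrowth a b w)
    (hφ : ∀ x < a, φ x < c)
    (hr : RestrictedGrowth c d ((List.range' a (b - a)).map φ)) :
    RestrictedGrowth c d (w.map φ) := by
  induction hw generalizing c with
  | nil => simpa using hr
  | old hx _ ih => exact old (hφ _ hx) (ih hφ hr)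
  | @new a b w hw ih =>
    have := hw.le
    rw [show b - a = (b - (a + 1)) + 1 by omega, List.range'_succ, List.map_cons] at hr
    rw [List.map_cons]
    generalize hy : φ a = y at hr ⊢
    cases hr with
    | old hlt hr =>
      refine old hlt (ih (fun x hx => ?_) hr)
      rcases Nat.lt_succ_iff_lt_or_eq.1 hx with h | rfl
      · exact hφ x h
      · omega
    | new hr =>
      refine new (ih (fun x hx => ?_) hr)
      rcases Nat.lt_succ_iff_lt_or_eq.1 hx with h | rfl
      · exact (hφ x h).trans (Nat.lt_succ_self _)
      · omega

lemma subst {a c : ℕ} {f g : List ℕ} (hf : RestrictedGrowth a (a + g.length) f)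
    (hg : RestrictedGrowth a c g) : RestrictedGrowth a c (f.map (paramSubst a g)) := by
  refine hf.map_of_range' _ (fun x hx => ?_) ?_
  · rwa [paramSubst_of_lt g hx]
  · rwa [Nat.add_sub_cancel_left, map_paramSubst_range']

lemma map_paramSubst_map_paramSubst {a : ℕ} {f h : List ℕ}
    (hf : RestrictedGrowth a (a + h.length) f) (g : List ℕ) :
    (f.map (paramSubst a h)).map (paramSubst a g) =
      f.map (paramSubst a (h.map (paramSubst a g))) := by
  rw [List.map_map]
  refine List.map_congr_left fun x hx => ?_
  have hlt := hf.lt_of_mem x hx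
  by_cases hxa : x < a
  · simp [paramSubst_of_lt _ hxa]
  · have hxh : x - a < h.length := by omega
    simp [paramSubst, hxa, hxh]

lemma map_paramShift {a b c : ℕ} {w : List ℕ} (hw : RestrictedGrowth c b w) (hac : a ≤ c) :
    RestrictedGrowth (c + 1) (b + 1) (w.map (paramShift a)) := by
  induction hw with
  | nil => exact nil _
  | old hx _ ih =>
    refine old ?_ (ih hac)
    unfold paramShift
    split_ifs <;> omega
  | @new c b w _ ih =>
    rw [List.map_cons, show paramShift a c = c + 1 by simp [paramShift, hac]]
    exact new (ih (by omega))

lemma length_constPrefix_lt {a b : ℕ} {w : List ℕ} (hw : RestrictedGrowth a b w) (hab : a < b) :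
    (constPrefix a w).length < w.length := by
  induction hw with
  | nil => omega
  | old hx _ ih => simpa [constPrefix_cons_of_lt _ hx] using ih hab
  | new _ _ => simp [constPrefix_cons_self]

lemma constPrefix_append {a b : ℕ} {u : List ℕ} (hu : RestrictedGrowth a b u) (hab : a < b)
    (φ : ℕ → ℕ) (hφ : ∀ x ≤ a, φ x = x) (w : List ℕ) :
    constPrefix a (u.map φ ++ w) = constPrefix a u := by
  induction hu with
  | nil => omega
  | @old a b x _ hx _ ih =>
    rw [List.map_cons, hφ x hx.le, List.cons_append, constPrefix_cons_of_lt _ hx,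
      constPrefix_cons_of_lt _ hx, ih hab hφ]
  | new _ _ => simp [hφ _ le_rfl, constPrefix_cons_self]

/-- Characterization of restricted growth words by positions of first occurrences. -/
lemma iff_exists_index {a b : ℕ} {w : List ℕ} :
    RestrictedGrowth a b w ↔ a ≤ b ∧ (∀ x ∈ w, x < b) ∧
      ∀ s, a ≤ s → s < b → ∃ i, ∃ hi : i < w.length, w[i] = s ∧
        ∀ j, ∀ hj : j ≤ i, w[j] ≤ s := by
  constructor
  · intro h
    refine ⟨h.le, h.lt_of_mem, ?_⟩
    induction h with
    | nil => intro s h1 h2; omega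
    | old hx _ ih =>
      intro s h1 h2
      obtain ⟨i, hi, his, hj⟩ := ih s h1 h2
      refine ⟨i + 1, by simpa using hi, by simpa using his, ?_⟩
      rintro (_ | j) hji
      · simp only [List.getElem_cons_zero]; omega
      · simpa using hj j (by omega)
    | new _ ih =>
      intro s h1 h2
      rcases h1.eq_or_lt with rfl | h1
      · refine ⟨0, by simp, by simp, ?_⟩
        intro j hj
        obtain rfl : j = 0 := by omega
        simp
      · obtain ⟨i, hi, his, hj⟩ := ih s h1 h2
        refine ⟨i + 1, by simpa using hi, by simpa using his, ?_⟩
        rintro (_ | j) hji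
        · simp only [List.getElem_cons_zero]; omega
        · simpa using hj j (by omega)
  · rintro ⟨hab, hlt, hocc⟩
    induction w generalizing a with
    | nil =>
      rcases hab.eq_or_lt with rfl | hab
      · exact nil _
      · obtain ⟨i, hi, -⟩ := hocc a le_rfl hab
        simp at hi
    | cons x w ih =>
      have hxb : x < b := hlt x (by simp)
      have hlt' : ∀ y ∈ w, y < b := fun y hy => hlt y (by simp [hy])
      have tail : ∀ s, s ≠ x → a ≤ s → s < b → ∃ i, ∃ hi : i < w.length, w[i] = s ∧
          ∀ j, ∀ hj : j ≤ i, w[j] ≤ s := by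
        intro s hsx h1 h2
        obtain ⟨i, hi, his, hj⟩ := hocc s h1 h2
        rcases i with _ | i
        · exact absurd (by simpa using his.symm) hsx
        · exact ⟨i, by simpa using hi, by simpa using his,
            fun j hji => by simpa using hj (j + 1) (by omega)⟩
      rcases lt_trichotomy x a with h | rfl | h
      · exact old h (ih hab hlt' fun s h1 h2 => tail s (by omega) h1 h2)
      · exact new (ih hxb hlt' fun s h1 h2 => tail s (by omega) (by omega) h2)
      · obtain ⟨i, hi, -, hj⟩ := hocc a le_rfl (h.trans hxb)
        have := hj 0 (Nat.zero_le _)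
        simp only [List.getElem_cons_zero] at this
        omega

end RestrictedGrowth

/-- The Graham–Rothschild property for `k`-parameter words over an alphabet of `a` letters. -/
def GrahamRothschild (a k : ℕ) : Prop :=
  ∀ (m : ℕ) (K : Type) [Finite K], ∃ n : ℕ, ∀ c : List ℕ → K,
    ∃ f, RestrictedGrowth a (a + m) f ∧ f.length = n ∧
      ∃ κ, ∀ g, RestrictedGrowth a (a + k) g → g.length = m → c (f.map (paramSubst a g)) = κ

lemma restrictedGrowth_flatMap_line {ι : Type} {a m : ℕ} (o : ι → Option (Fin m → Fin a))
    (L : List ι) (hL : ∃ i ∈ L, o i = none) :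
    RestrictedGrowth a (a + m) (L.flatMap fun i =>
      (o i).elim (List.range' a m) fun v => List.ofFn fun j => (v j : ℕ)) := by
  induction L with
  | nil => simp at hL
  | cons i L ih =>
    rw [List.flatMap_cons]
    cases hi : o i with
    | none =>
      refine (RestrictedGrowth.range' a m).append (RestrictedGrowth.of_forall_lt ?_)
      intro x hx
      obtain ⟨j, -, hx⟩ := List.mem_flatMap.1 hx
      cases hj : o j with
      | none =>
        simp only [hj, Option.elim_none, List.mem_range'_1] at hx
        exact hx.2
      | some v =>
        simp only [hj, Option.elim_some, List.mem_ofFn] at hx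
        obtain ⟨t, rfl⟩ := hx
        omega
    | some v =>
      refine RestrictedGrowth.append (b := a) (RestrictedGrowth.of_forall_lt ?_) (ih ?_)
      · intro x hx
        simp only [Option.elim_some, List.mem_ofFn] at hx
        obtain ⟨t, rfl⟩ := hx
        exact (v t).2
      · obtain ⟨j, hj, hjo⟩ := hL
        rcases List.mem_cons.1 hj with rfl | hj
        · simp [hi] at hjo
        · exact ⟨j, hj, hjo⟩

/-- The multidimensional Hales–Jewett theorem, in terms of parameter words. -/
lemma grahamRothschild_zero (a : ℕ) : GrahamRothschild a 0 := by
  intro m K _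
  obtain ⟨ι, _, hι⟩ := Combinatorics.Line.exists_mono_in_high_dimension (Fin m → Fin a) K
  refine ⟨Fintype.card ι * m, fun c => ?_⟩
  obtain ⟨l, κ, hl⟩ := hι fun y =>
    c ((Finset.univ : Finset ι).toList.flatMap fun i => List.ofFn fun j => (y i j : ℕ))
  refine ⟨_, restrictedGrowth_flatMap_line l.idxFun Finset.univ.toList ?_, ?_, κ, ?_⟩
  · obtain ⟨i, hi⟩ := l.proper
    exact ⟨i, by simp, hi⟩
  · rw [List.length_flatMap, List.map_congr_left (g := fun _ => m)]
    · simp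
    · intro i _
      cases l.idxFun i <;> simp
  · rintro g hg rfl
    have hga := hg.lt_of_mem
    rw [← hl fun j => ⟨g[j], hga _ (List.getElem_mem _)⟩]
    congr 1
    rw [List.map_flatMap]
    congr 1
    funext i
    cases hi : l.idxFun i with
    | none => simp [map_paramSubst_range', hi]
    | some v =>
      simp only [Option.elim_some, Combinatorics.Line.coe_apply, hi, Option.getD_some]
      refine map_paramSubst_eq_self g fun x hx => ?_
      obtain ⟨t, rfl⟩ := (List.mem_ofFn' _ _).1 hx
      exact (v t).2

/-- Some subspace makes the color of a word depend only on the part before its first parameter. -/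
lemma GrahamRothschild.exists_color_eq_constPrefix {a k : ℕ} (h : GrahamRothschild (a + 1) k)
    (m : ℕ) (K : Type) [Finite K] : ∃ n : ℕ, ∀ c : List ℕ → K,
      ∃ f, RestrictedGrowth a (a + m) f ∧ f.length = n ∧ ∃ d : List ℕ → K,
        ∀ g, RestrictedGrowth a (a + (k + 1)) g → g.length = m →
          c (f.map (paramSubst a g)) = d (constPrefix a g) := by
  induction m generalizing K with
  | zero =>
    refine ⟨0, fun c => ⟨[], RestrictedGrowth.nil a, rfl, fun _ => c [], ?_⟩⟩
    simp
  | succ m ih =>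
    obtain ⟨m₁, h₁⟩ := ih (Fin a → K)
    obtain ⟨n, hn⟩ := h m₁ K
    refine ⟨n + 1, fun c => ?_⟩
    obtain ⟨f₁, hf₁, hlen₁, κ, hκ⟩ := hn fun w => c (a :: w)
    obtain ⟨f₂, hf₂, hlen₂, d, hd⟩ :=
      h₁ fun w x => c ((a :: f₁).map (paramSubst a ((x : ℕ) :: w)))
    have hF : RestrictedGrowth a (a + (a :: f₂.map (paramShift a)).length) (a :: f₁) := by
      refine RestrictedGrowth.new ?_
      rwa [List.length_cons, List.length_map, hlen₂, show a + (m₁ + 1) = a + 1 + m₁ by omega]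
    have hS := hf₂.map_paramShift le_rfl
    refine ⟨(a :: f₁).map (paramSubst a (a :: f₂.map (paramShift a))),
      hF.subst (RestrictedGrowth.new hS), by simp [hlen₁],
      fun u => match u with
        | [] => κ
        | x :: u => if hx : x < a then d u ⟨x, hx⟩ else κ, ?_⟩
    intro g hg hgm
    rw [hF.map_paramSubst_map_paramSubst]
    cases hg with
    | @old _ _ x g' hx hg' =>
      rw [map_cons_paramShift_map_paramSubst, constPrefix_cons_of_lt _ hx]
      simpa [hx] using congrFun (hd g' hg' (by simpa using hgm)) ⟨x, hx⟩
    | @new _ _ v hv =>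
      rw [constPrefix_cons_self]
      have hvm : v.length = m := by simpa using hgm
      have hS' : RestrictedGrowth (a + 1) (a + 1 + v.length) (f₂.map (paramShift a)) := by
        rwa [hvm, show a + 1 + m = a + m + 1 by omega]
      have hv' : RestrictedGrowth (a + 1) (a + 1 + k) v := by
        rwa [show a + 1 + k = a + (k + 1) by omega]
      have := hκ _ (hS'.subst hv') (by simpa using hlen₂)
      simpa [paramSubst_cons_self, paramSubst_of_lt] using this

/-- Some subspace makes the color of the part of a word before its first parameter depend only on
the position of that parameter. -/
lemma exists_color_constPrefix_eq_length (a k m : ℕ) (K : Type) [Finite K] :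
    ∃ n : ℕ, ∀ d : List ℕ → K,
      ∃ f, RestrictedGrowth a (a + m) f ∧ f.length = n ∧ ∃ e : ℕ → K,
        ∀ g, RestrictedGrowth a (a + (k + 1)) g → g.length = m →
          d (constPrefix a (f.map (paramSubst a g))) = e (constPrefix a g).length := by
  induction m generalizing K with
  | zero =>
    refine ⟨0, fun d => ⟨[], RestrictedGrowth.nil a, rfl, fun _ => d [], ?_⟩⟩
    simp [constPrefix]
  | succ m ih =>
    obtain ⟨l, hl⟩ := grahamRothschild_zero a 1 (Fin m → K)
    obtain ⟨n, hn⟩ := ih ((Fin l → Fin a) → K)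
    refine ⟨l + n, fun d => ?_⟩
    obtain ⟨f₂, hf₂, hlen₂, e, he⟩ := hn fun w y => d (List.ofFn (fun i => (y i : ℕ)) ++ w)
    obtain ⟨L, hL, hLlen, E, hE⟩ := hl fun w i =>
      if h : w.length = l ∧ ∀ x ∈ w, x < a then
        e i fun j => ⟨w[j]'(h.1.symm ▸ j.2), h.2 _ (List.getElem_mem _)⟩
      else d []
    have hS := hf₂.map_paramShift le_rfl
    refine ⟨L ++ f₂.map (paramShift a), hL.append (by
      rwa [show a + (m + 1) = a + m + 1 by omega]), by simp [hLlen, hlen₂],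
      fun i => match i with
        | 0 => d (constPrefix a L)
        | i + 1 => if hi : i < m then E ⟨i, hi⟩ else d [], ?_⟩
    intro g hg hgm
    rw [List.map_append]
    cases hg with
    | @new _ _ v hv =>
      rw [constPrefix_cons_self, hL.constPrefix_append (by omega)]
      · rfl
      · intro x hx
        rw [paramSubst_cons_self, paramSubst_of_lt _ (by omega)]
    | @old _ _ x g' hx hg' =>
      have hgm' : g'.length = m := by simpa using hgm
      have hlen := hg'.length_constPrefix_lt (by omega)
      have hLx : L.map (paramSubst a (x :: g')) = L.map (paramSubst a [x]) := by
        refine List.map_congr_left fun z hz => ?_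
        have := hL.lt_of_mem z hz
        by_cases hza : z < a
        · simp [paramSubst_of_lt _ hza]
        · obtain rfl : z = a := by omega
          simp [paramSubst_cons_self_param]
      have hx1 : RestrictedGrowth a a [x] := RestrictedGrowth.old hx (RestrictedGrowth.nil a)
      have hlt := (RestrictedGrowth.subst (g := [x]) hL hx1).lt_of_mem
      have hsh : (f₂.map (paramShift a)).map (paramSubst a (x :: g')) =
          f₂.map (paramSubst a g') := by
        simp [paramSubst_cons_paramShift]
      rw [hLx, hsh, constPrefix_append_of_lt _ hlt, constPrefix_cons_of_lt _ hx]
      have hEx := congrFun (hE [x] hx1 rfl) ⟨(constPrefix a g').length, by omega⟩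
      have hcond : (L.map (paramSubst a [x])).length = l ∧
          ∀ z ∈ L.map (paramSubst a [x]), z < a := ⟨by simp [hLlen], hlt⟩
      rw [dif_pos hcond, ← he g' hg' hgm'] at hEx
      simp only [List.length_cons]
      rw [dif_pos (by omega), ← hEx]
      congr 2
      apply List.ext_getElem <;> simp [hLlen]

/-- If enough positions satisfy `P`, some subspace has all its first parameters at such
positions. -/
lemma exists_length_constPrefix_mem {a : ℕ} (ha : 0 < a) (k m n : ℕ) (P : ℕ → Prop)
    [DecidablePred P] (hm : m ≤ Nat.count P n) :
    ∃ f, RestrictedGrowth a (a + m) f ∧ f.length = n ∧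
      ∀ g, RestrictedGrowth a (a + (k + 1)) g → g.length = m →
        P (constPrefix a (f.map (paramSubst a g))).length := by
  induction n generalizing m P with
  | zero =>
    obtain rfl : m = 0 := by simpa using hm
    refine ⟨[], RestrictedGrowth.nil a, rfl, fun g hg hgm => ?_⟩
    have := hg.length_constPrefix_lt (by omega)
    omega
  | succ n ih =>
    rw [Nat.count_succ'] at hm
    by_cases hlt : m ≤ Nat.count (fun i => P (i + 1)) n
    · obtain ⟨f, hf, hlen, h⟩ := ih m _ hlt
      refine ⟨0 :: f, RestrictedGrowth.old ha hf, by simp [hlen], fun g hg hgm => ?_⟩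
      simpa [paramSubst_of_lt _ ha, constPrefix_cons_of_lt _ ha] using h g hg hgm
    · have h0 : P 0 := by
        by_contra h0
        simp [h0] at hm
        omega
      rw [if_pos h0] at hm
      obtain ⟨m, rfl⟩ : ∃ t, m = t + 1 := ⟨m - 1, by omega⟩
      obtain ⟨f, hf, hlen, h⟩ := ih m (fun i => P (i + 1)) (by omega)
      refine ⟨a :: f.map (paramShift a), RestrictedGrowth.new (hf.map_paramShift le_rfl),
        by simp [hlen], fun g hg hgm => ?_⟩
      cases hg with
      | @old _ _ x g' hx hg' =>
        rw [map_cons_paramShift_map_paramSubst, constPrefix_cons_of_lt _ hx]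
        exact h g' hg' (by simpa using hgm)
      | @new _ _ v hv =>
        rw [map_cons_paramShift_map_paramSubst, constPrefix_cons_self]
        exact h0

lemma exists_le_count_eq {K : Type} [Fintype K] [DecidableEq K] (e : ℕ → K) (m : ℕ) :
    ∃ κ, m ≤ Nat.count (fun i => e i = κ) (Fintype.card K * m) := by
  have : Nonempty K := ⟨e 0⟩
  obtain ⟨κ, -, hκ⟩ := Finset.exists_le_card_fiber_of_mul_le_card_of_maps_to
    (s := Finset.range (Fintype.card K * m)) (t := Finset.univ) (f := e) (n := m)
    (fun _ _ => Finset.mem_univ _) Finset.univ_nonempty (by simp)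
  exact ⟨κ, by rwa [Nat.count_eq_card_filter_range]⟩

lemma GrahamRothschild.succ {a k : ℕ} (ha : 0 < a) (h : GrahamRothschild (a + 1) k) :
    GrahamRothschild a (k + 1) := by
  classical
  intro m K _
  cases nonempty_fintype K
  obtain ⟨n₂, h₂⟩ := exists_color_constPrefix_eq_length a k (Fintype.card K * m) K
  obtain ⟨n₁, h₁⟩ := h.exists_color_eq_constPrefix n₂ K
  refine ⟨n₁, fun c => ?_⟩
  obtain ⟨f₁, hf₁, hlen₁, d, hd⟩ := h₁ c
  obtain ⟨f₂, hf₂, rfl, e, he⟩ := h₂ d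
  obtain ⟨κ, hκ⟩ := exists_le_count_eq e m
  obtain ⟨f₃, hf₃, hlen₃, h₃⟩ := exists_length_constPrefix_mem ha k m _ _ hκ
  rw [← hlen₃] at hf₂
  have hf₁' : RestrictedGrowth a (a + (f₂.map (paramSubst a f₃)).length) f₁ := by simpa using hf₁
  refine ⟨f₁.map (paramSubst a (f₂.map (paramSubst a f₃))), hf₁'.subst (hf₂.subst hf₃),
    by simpa using hlen₁, κ, ?_⟩
  rintro g hg rfl
  have hg₃ := hf₃.subst hg
  have hg₂ : RestrictedGrowth a (a + (k + 1))
      (f₂.map (paramSubst a (f₃.map (paramSubst a g)))) :=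
    RestrictedGrowth.subst (by simpa using hf₂) hg₃
  rw [hf₁'.map_paramSubst_map_paramSubst, hf₂.map_paramSubst_map_paramSubst,
    hd _ hg₂ (by simp), he _ hg₃ (by simpa using hlen₃)]
  exact h₃ g hg rfl

/-- The Graham–Rothschild theorem for parameter words over a nonempty alphabet. -/
theorem grahamRothschild {a : ℕ} (ha : 0 < a) (k : ℕ) : GrahamRothschild a k := by
  induction k generalizing a with
  | zero => exact grahamRothschild_zero a
  | succ k ih => exact (ih (Nat.succ_pos a)).succ ha

lemma RestrictedGrowth.isRigidSurjection {S : Type*} [LinearOrder S] {q n : ℕ} (e : S ≃o Fin q)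
    {w : List ℕ} (hw : RestrictedGrowth 0 q w) (hn : w.length = n) :
    IsRigidSurjection fun i : Fin n =>
      e.symm ⟨w[i]'(hn ▸ i.2), hw.lt_of_mem _ (List.getElem_mem _)⟩ := by
  have hocc := (RestrictedGrowth.iff_exists_index.1 hw).2.2
  subst hn
  constructor
  · intro s
    obtain ⟨i, hi, his, -⟩ := hocc (e s) (Nat.zero_le _) (e s).2
    exact ⟨⟨i, hi⟩, by simp [his]⟩
  · intro s₀ s₁ hs
    obtain ⟨i, hi, his, hj⟩ := hocc (e s₀) (Nat.zero_le _) (e s₀).2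
    refine ⟨⟨i, hi⟩, by simp [his], ?_⟩
    rintro b rfl
    by_contra hb
    have h1 := hj b (Fin.le_def.1 (not_lt.1 hb))
    have h2 := e.lt_iff_lt.2 hs
    rw [OrderIso.apply_symm_apply, Fin.lt_def] at h2
    exact absurd h2 (not_lt.2 h1)

lemma IsRigidSurjection.restrictedGrowth {R S : Type*} [LinearOrder R] [LinearOrder S] {p q : ℕ}
    (eR : R ≃o Fin p) (eS : S ≃o Fin q) {σ : S → R} (hσ : IsRigidSurjection σ) :
    RestrictedGrowth 0 p (List.ofFn fun j : Fin q => (eR (σ (eS.symm j)) : ℕ)) := by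
  rw [RestrictedGrowth.iff_exists_index]
  refine ⟨Nat.zero_le _, ?_, ?_⟩
  · intro x hx
    obtain ⟨t, rfl⟩ := (List.mem_ofFn' _ _).1 hx
    exact Fin.is_lt _
  · intro s _ hs
    have hex : ∃ i, ∃ hi : i < q, eR (σ (eS.symm ⟨i, hi⟩)) = ⟨s, hs⟩ := by
      obtain ⟨x, hx⟩ := hσ.1 (eR.symm ⟨s, hs⟩)
      exact ⟨eS x, (eS x).2, by simp [hx]⟩
    classical
    obtain ⟨hi, his⟩ := Nat.find_spec hex
    refine ⟨Nat.find hex, by simpa using hi, by simp [his], fun j hj => ?_⟩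
    simp only [List.getElem_ofFn]
    by_contra! hlt
    obtain ⟨x, hx, hmin⟩ := hσ.2 (eR.symm ⟨s, hs⟩) (σ (eS.symm ⟨j, hj.trans_lt hi⟩))
      (eR.symm_apply_lt.2 hlt)
    have hxj := eS.lt_symm_apply.1 (hmin _ rfl)
    exact Nat.find_min hex (lt_of_lt_of_le hxj hj) ⟨(eS x).2, by simp [hx]⟩

/-- The Dual Ramsey Theorem of Graham and Rothschild, in its rigid surjection formulation:
for finite linear orders `R`, `S` with `|R| < |S|` and `r ∈ ℕ` there is `n > |S|` such that
every `r`-coloring of the rigid surjections `Epi(n, R)` has a monochromatic set of the form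
`Epi(S, R) ∘ γ` for some rigid surjection `γ ∈ Epi(n, S)`. -/
theorem dual_ramsey_rigid_surjections
    (R S : Type) [Fintype R] [LinearOrder R] [Fintype S] [LinearOrder S]
    (hRS : Fintype.card R < Fintype.card S) (r : ℕ) :
    ∃ n : ℕ, Fintype.card S < n ∧
      ∀ c : (Fin n → R) → Fin r, ∃ γ : Fin n → S, IsRigidSurjection γ ∧
        ∀ σ σ' : S → R, IsRigidSurjection σ → IsRigidSurjection σ' →
          c (σ ∘ γ) = c (σ' ∘ γ) := by
  have eR : R ≃o Fin (Fintype.card R) := (Fintype.orderIsoFinOfCardEq R rfl).symm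
  have eS : S ≃o Fin (Fintype.card S) := (Fintype.orderIsoFinOfCardEq S rfl).symm
  generalize Fintype.card R = p at *
  generalize Fintype.card S = q at *
  obtain ⟨q, rfl⟩ : ∃ t, q = t + 1 := ⟨q - 1, by omega⟩
  rcases p with _ | p
  · have hw : RestrictedGrowth 0 (q + 1) (List.range' 0 (q + 1) ++ [0]) :=
      RestrictedGrowth.append (by simpa using RestrictedGrowth.range' 0 (q + 1))
        (RestrictedGrowth.of_forall_lt (by simp))
    exact ⟨q + 2, by omega, fun c => ⟨_, hw.isRigidSurjection eS (by simp),
      fun σ => (eR (σ (eS.symm 0))).elim0⟩⟩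
  obtain ⟨n, hn⟩ := grahamRothschild one_pos p q (Fin r)
  refine ⟨q + 2 + n, by omega, fun c => ?_⟩
  let decode : List ℕ → Fin (q + 2 + n) → R := fun w i =>
    eR.symm (Fin.ofNat (p + 1) ((List.replicate (q + 2) 0 ++ w).getD i 0))
  obtain ⟨f, hf, hlen, κ, hκ⟩ := hn fun w => c (decode w)
  have hw : RestrictedGrowth 0 (q + 1) (List.replicate (q + 2) 0 ++ f) := by
    rw [List.replicate_succ, List.cons_append]
    refine RestrictedGrowth.new (RestrictedGrowth.append (b := 1)
      (RestrictedGrowth.of_forall_lt ?_) (by rwa [add_comm q 1]))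
    simp
  refine ⟨_, hw.isRigidSurjection eS (by simp [hlen]), ?_⟩
  suffices key : ∀ σ : S → R, IsRigidSurjection σ → c (σ ∘ _) = κ from
    fun σ σ' hσ hσ' => (key σ hσ).trans (key σ' hσ').symm
  intro σ hσ
  have hg := hσ.restrictedGrowth eR eS
  generalize hgw : (List.ofFn fun j : Fin (q + 1) => (eR (σ (eS.symm j)) : ℕ)) = g at hg
  have hval : ∀ (x : ℕ) (hx : x < q + 1), (eR (σ (eS.symm ⟨x, hx⟩)) : ℕ) = paramSubst 0 g x := by
    intro x hx
    have hxg : x < g.length := by simpa [← hgw] using hx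
    rw [paramSubst, if_neg (Nat.not_lt_zero x), Nat.sub_zero, List.getD_eq_getElem _ _ hxg]
    simp only [← hgw, List.getElem_ofFn]
  have hglen : g.length = q + 1 := by simp [← hgw]
  clear hgw
  cases hg with
  | old hx _ => exact absurd hx (Nat.not_lt_zero _)
  | @new _ _ g hg =>
    rw [paramSubst_cons_self] at hval
    rw [← hκ g (by rwa [add_comm 1 p]) (by simpa using hglen)]
    congr 1
    funext i
    have hi : (i : ℕ) < (List.replicate (q + 2) 0 ++ f).length := by simp [hlen]
    have hmap : List.replicate (q + 2) 0 ++ f.map (paramSubst 1 g) =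
        (List.replicate (q + 2) 0 ++ f).map (paramSubst 1 g) := by
      simp [paramSubst_of_lt]
    apply eR.injective
    simp only [decode, OrderIso.apply_symm_apply, Function.comp_apply]
    apply Fin.ext
    rw [hmap, List.getD_eq_getElem _ _ (by simpa using hi), List.getElem_map, hval,
      Fin.val_ofNat, Nat.mod_eq_of_lt]
    · rfl
    · rw [← hval _ (hw.lt_of_mem _ (List.getElem_mem _))]
      exact Fin.is_lt _
end

section
/- For all k, m, r ∈ ℕ there exists n ∈ ℕ such that for every r-coloring of the set of n×k Boolean matrices, there exists an n×m ordered Boolean matrix R such that the color of R·B depends only on π(B), for every m×k Boolean matrix B; here π(B) is the unique permutation matrix such that B·π(B) is an ordered Boolean matrix. -/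
/-- An `n × k` Boolean matrix: a `{0,1}`-matrix whose columns, viewed as subsets of
`Fin n`, form a partition of `Fin n` into `k` nonempty pieces (each row has exactly one `1`,
each column contains a `1`). -/
def IsBooleanMatrix {n k : ℕ} (A : Matrix (Fin n) (Fin k) ℕ) : Prop :=
  (∀ i j, A i j = 0 ∨ A i j = 1) ∧ (∀ i, ∃! j, A i j = 1) ∧ (∀ j, ∃ i, A i j = 1)

/-- An ordered Boolean matrix: a Boolean matrix whose columns `(P_j)` satisfy
`min P_j < min P_{j'}` whenever `j < j'`. -/
def IsOrderedBooleanMatrix {n k : ℕ} (A : Matrix (Fin n) (Fin k) ℕ) : Prop :=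
  IsBooleanMatrix A ∧
    ∀ j j' : Fin k, j < j' → ∃ i, A i j = 1 ∧ ∀ i', A i' j' = 1 → i < i'

/-- The permutation matrix associated to `σ`. -/
def permMatrix {k : ℕ} (σ : Equiv.Perm (Fin k)) : Matrix (Fin k) (Fin k) ℕ :=
  fun i j => if σ i = j then 1 else 0

namespace DualRamsey

open List

/-- `IsRigid k w`: the list `w` is a surjection onto `{0, …, k - 1}` in which the first
occurrences of the letters `0, …, k - 1` appear in increasing order. -/
def IsRigid : ℕ → List ℕ → Prop
  | 0, w => w = []
  | k + 1, w => ∃ u v, w = u ++ k :: v ∧ IsRigid k u ∧ ∀ x ∈ v, x < k + 1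

/-- The word obtained from `R` by replacing each letter `i` by the `i`-th letter of `B`. -/
def subst (R B : List ℕ) : List ℕ := R.map fun i => B.getD i 0

/-- The part of the word `R` that precedes the first letter that is at least `t`. -/
def before (t : ℕ) (R : List ℕ) : List ℕ := R.takeWhile (· < t)

@[simp] lemma length_subst (R B : List ℕ) : (subst R B).length = R.length := by simp [subst]

lemma subst_append (u v B : List ℕ) : subst (u ++ v) B = subst u B ++ subst v B := by
  simp [subst]

lemma subst_cons (i : ℕ) (v B : List ℕ) : subst (i :: v) B = B.getD i 0 :: subst v B := rfl

lemma subst_subst {R S : List ℕ} (B : List ℕ) (h : ∀ i ∈ R, i < S.length) :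
    subst (subst R S) B = subst R (subst S B) := by
  simp only [subst, map_map]
  refine map_congr_left fun i hi => ?_
  have := h i hi
  simp [List.getD, this]

lemma subst_append_right {S u : List ℕ} (y : List ℕ) (h : ∀ i ∈ S, i < u.length) :
    subst S (u ++ y) = subst S u := by
  refine map_congr_left fun i hi => ?_
  have := h i hi
  simp [List.getD, List.getElem?_append_left this]

lemma subst_range_length (u : List ℕ) : subst (range u.length) u = u := by
  apply List.ext_getElem <;> simp +contextual [subst, List.getD]

lemma subst_range_append {p : ℕ} {u : List ℕ} (hu : u.length = p) (y : List ℕ) :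
    subst (range p) (u ++ y) = u := by
  subst hu
  rw [subst_append_right _ (by simp), subst_range_length]

lemma mem_of_mem_subst {S B : List ℕ} {x : ℕ} (h : ∀ i ∈ S, i < B.length)
    (hx : x ∈ subst S B) : x ∈ B := by
  obtain ⟨i, hi, rfl⟩ := List.mem_map.1 hx
  have := h i hi
  simp [List.getD, this]

namespace IsRigid

lemma lt {k : ℕ} {w : List ℕ} (h : IsRigid k w) : ∀ x ∈ w, x < k := by
  induction k generalizing w with
  | zero => obtain rfl : w = [] := h; simp
  | succ k ih =>
    obtain ⟨u, v, rfl, hu, hv⟩ := h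
    have := ih hu
    grind

lemma append {k : ℕ} {w : List ℕ} (h : IsRigid k w) {v : List ℕ} (hv : ∀ x ∈ v, x < k) :
    IsRigid k (w ++ v) := by
  cases k with
  | zero =>
    obtain rfl : v = [] := List.eq_nil_iff_forall_not_mem.2 fun x hx => by simpa using hv x hx
    simpa using h
  | succ k =>
    obtain ⟨u, v', rfl, hu, hv'⟩ := h
    exact ⟨u, v' ++ v, by simp, hu, by grind⟩

lemma snoc {k : ℕ} {w : List ℕ} (h : IsRigid k w) : IsRigid (k + 1) (w ++ [k]) :=
  ⟨w, [], rfl, h, by simp⟩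

lemma of_concat {k x : ℕ} {w : List ℕ} (h : IsRigid k (w ++ [x])) :
    IsRigid k w ∨ ∃ l, k = l + 1 ∧ x = l ∧ IsRigid l w := by
  cases k with
  | zero => exact absurd h (by simp [IsRigid])
  | succ k =>
    obtain ⟨u, v, he, hu, hv⟩ := h
    rcases List.eq_nil_or_concat v with rfl | ⟨v', y, rfl⟩
    · obtain ⟨rfl, h2⟩ := List.append_inj' he rfl
      exact .inr ⟨k, rfl, by simpa using h2, hu⟩
    · rw [List.concat_eq_append] at he hv
      rw [← List.cons_append, ← List.append_assoc] at he
      obtain ⟨rfl, h2⟩ := List.append_inj' he rfl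
      exact .inl ⟨u, v', rfl, hu, fun z hz => hv z (by simp [hz])⟩

lemma append_range' {p : ℕ} {u : List ℕ} (h : IsRigid p u) (d : ℕ) :
    IsRigid (p + d) (u ++ range' p d) := by
  induction d with
  | zero => simpa using h
  | succ d ih =>
    rw [List.range'_concat, ← List.append_assoc, ← Nat.add_assoc]
    simpa using ih.snoc

lemma range (m : ℕ) : IsRigid m (List.range m) := by
  simpa [List.range_eq_range'] using append_range' (p := 0) (u := []) rfl m

lemma before_append_cons {t : ℕ} {u : List ℕ} (h : IsRigid t u) (v : List ℕ) :
    before t (u ++ t :: v) = u := by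
  rw [before, List.takeWhile_append_of_pos (by simpa using h.lt)]
  simp

lemma split {m t : ℕ} {R : List ℕ} (h : IsRigid m R) (ht : t < m) :
    (∃ v, R = before t R ++ t :: v) ∧ IsRigid t (before t R) := by
  induction m generalizing R with
  | zero => omega
  | succ m ih =>
    obtain ⟨u, v, rfl, hu, hv⟩ := h
    rcases Nat.lt_succ_iff_lt_or_eq.1 ht with h | rfl
    · obtain ⟨⟨v', h1⟩, h2⟩ := ih hu h
      have : before t (u ++ m :: v) = before t u := by
        conv_lhs => rw [h1, List.append_assoc, List.cons_append]
        exact h2.before_append_cons _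
      rw [this]
      exact ⟨⟨v' ++ m :: v, by conv_lhs => rw [h1]; simp⟩, h2⟩
    · rw [hu.before_append_cons]
      exact ⟨⟨v, rfl⟩, hu⟩

lemma mem {m t : ℕ} {R : List ℕ} (h : IsRigid m R) (ht : t < m) : t ∈ R := by
  obtain ⟨⟨v, h1⟩, -⟩ := h.split ht
  rw [h1]; simp

lemma le_length {m : ℕ} {R : List ℕ} (h : IsRigid m R) : m ≤ R.length := by
  have : List.range m <+~ R :=
    List.subperm_of_subset List.nodup_range fun i hi => h.mem (by simpa using hi)
  simpa using this.length_le

lemma before_append {m t : ℕ} {R : List ℕ} (h : IsRigid m R) (ht : t < m) (v : List ℕ) :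
    before t (R ++ v) = before t R := by
  obtain ⟨⟨v', h1⟩, h2⟩ := h.split ht
  conv_lhs => rw [h1, List.append_assoc, List.cons_append]
  exact h2.before_append_cons _

lemma subst_take {m k : ℕ} {R B : List ℕ} (hR : IsRigid m R) (hm : m ≤ B.length)
    (hB : IsRigid k (B.take m)) : IsRigid k (subst R B) := by
  induction m generalizing R k with
  | zero =>
    obtain rfl : R = [] := hR
    simpa [DualRamsey.subst] using hB
  | succ m ih =>
    have hlt : ∀ x ∈ DualRamsey.subst R B, x < k := by
      intro x hx
      obtain ⟨i, hi, rfl⟩ := List.mem_map.1 hx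
      have h1 := hR.lt i hi
      refine hB.lt _ ?_
      rw [List.mem_take_iff_getElem]
      exact ⟨i, by omega, by simp [List.getD, show i < B.length by omega]⟩
    obtain ⟨u, v, rfl, hu, hv⟩ := hR
    have hget : B.getD m 0 = B[m] := by simp [List.getD, show m < B.length by omega]
    rw [List.take_succ_eq_append_getElem (by omega)] at hB
    rw [subst_append, subst_cons, hget] at hlt ⊢
    rcases hB.of_concat with h | ⟨l, rfl, hl, h⟩
    · exact (ih hu (by omega) h).append fun x hx => hlt x (by simp at hx ⊢; tauto)
    · rw [hl] at hlt ⊢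
      exact ⟨_, _, rfl, ih hu (by omega) h, fun x hx => hlt x (by simp [hx])⟩

lemma subst {m k : ℕ} {R B : List ℕ} (hR : IsRigid m R) (hB : IsRigid k B)
    (hm : B.length = m) : IsRigid k (subst R B) :=
  hR.subst_take hm.ge (by rwa [List.take_of_length_le hm.le])

lemma before_subst {m k t : ℕ} {R S : List ℕ} (hR : IsRigid m R) (hS : IsRigid k S)
    (hm : S.length = m) (ht : t < k) :
    before t (DualRamsey.subst R S) =
      DualRamsey.subst (before (before t S).length R) (before t S) := by
  obtain ⟨⟨v, h1⟩, h2⟩ := hS.split ht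
  set u := before t S
  have hs : u.length < m := by rw [← hm, h1]; simp
  obtain ⟨⟨v', h3⟩, h4⟩ := hR.split hs
  set w := before u.length R
  have : DualRamsey.subst R S = DualRamsey.subst w u ++ t :: DualRamsey.subst v' S := by
    rw [h3, subst_append, subst_cons, h1, subst_append_right _ h4.lt]
    simp [List.getD]
  rw [this]
  exact (h4.subst h2 rfl).before_append_cons _

lemma of_forall_split {k : ℕ} {w : List ℕ} (hlt : ∀ x ∈ w, x < k)
    (h : ∀ j < k, ∃ u v, w = u ++ j :: v ∧ ∀ x ∈ u, x < j) : IsRigid k w := by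
  induction k generalizing w with
  | zero => exact List.eq_nil_iff_forall_not_mem.2 fun x hx => by simpa using hlt x hx
  | succ k ih =>
    obtain ⟨u, v, rfl, hu⟩ := h k (by omega)
    refine ⟨u, v, rfl, ih hu fun j hj => ?_, fun x hx => hlt x (by simp [hx])⟩
    obtain ⟨u', v', he, hu'⟩ := h j (by omega)
    rcases List.append_eq_append_iff.1 he with ⟨a, rfl, h2⟩ | ⟨a, rfl, h2⟩
    · cases a with
      | nil => simp at h2; omega
      | cons b a =>
        obtain ⟨rfl, -⟩ := by simpa using h2
        have := hu' k (by simp)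
        omega
    · cases a with
      | nil => simp at h2; omega
      | cons b a =>
        obtain ⟨rfl, -⟩ := by simpa using h2
        exact ⟨u', a, rfl, hu'⟩

end IsRigid

lemma isRigid_flatMap {ι : Type*} {p d : ℕ} {block : ι → List ℕ} {L : List ι} {u : List ℕ}
    (hu : IsRigid p u) (hblock : ∀ i, block i = range' p d ∨ ∀ x ∈ block i, x < p)
    (hL : ∃ i ∈ L, block i = range' p d) : IsRigid (p + d) (u ++ L.flatMap block) := by
  have hlt : ∀ L : List ι, ∀ x ∈ L.flatMap block, x < p + d := by
    intro L x hx
    obtain ⟨i, -, hi⟩ := List.mem_flatMap.1 hx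
    rcases hblock i with h | h
    · rw [h, List.mem_range'_1] at hi
      exact hi.2
    · exact (h x hi).trans_le (Nat.le_add_right _ _)
  induction L generalizing u with
  | nil => simp at hL
  | cons i L ih =>
    rw [List.flatMap_cons, ← List.append_assoc]
    by_cases hi : block i = range' p d
    · rw [hi]
      exact (hu.append_range' d).append (hlt L)
    · refine ih (hu.append ((hblock i).resolve_left hi)) ?_
      obtain ⟨j, hj, hj'⟩ := hL
      rcases List.mem_cons.1 hj with rfl | hj
      · exact absurd hj' hi
      · exact ⟨j, hj, hj'⟩

/-- The Hales-Jewett theorem in terms of words: after a prefix `u` of length `p`, the color no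
longer depends on the remaining letters `y`, provided they all occur in `u`. -/
lemma exists_rigid_forget_tail (κ : Type) [Finite κ] (q p d : ℕ) :
    ∃ n, ∀ c : List ℕ → κ, ∃ S : List ℕ, S.length = n ∧ IsRigid (p + d) (range p ++ S) ∧
      ∀ u y y' : List ℕ, u.length = p → y.length = d → y'.length = d → (∀ x ∈ u, x < q) →
        y ⊆ u → y' ⊆ u →
        c (subst (range p ++ S) (u ++ y)) = c (subst (range p ++ S) (u ++ y')) := by
  obtain ⟨ι, _, hι⟩ := Combinatorics.Line.exists_mono_in_high_dimension (Fin d → Fin p)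
    ((Fin p → Fin q) → κ)
  refine ⟨Fintype.card ι * d, fun c => ?_⟩
  obtain ⟨l, a, hl⟩ := hι fun X u => c (ofFn (fun i => (u i : ℕ)) ++
    Finset.univ.toList.flatMap fun i => ofFn fun e => (u (X i e) : ℕ))
  let block (i : ι) : List ℕ :=
    (l.idxFun i).elim (range' p d) fun f => ofFn fun e => (f e : ℕ)
  have hlen : ∀ i, (block i).length = d := by
    intro i
    cases h : l.idxFun i <;> simp [block, h]
  refine ⟨Finset.univ.toList.flatMap block, by simp [List.length_flatMap, hlen],
    isRigid_flatMap (.range p) (fun i => ?_) ?_, ?_⟩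
  · cases h : l.idxFun i
    · simp [block, h]
    · right
      simp [block, h, List.mem_ofFn]
  · obtain ⟨i, hi⟩ := l.proper
    exact ⟨i, by simp, by simp [block, hi]⟩
  · have key : ∀ (u y : List ℕ) (hu : u.length = p) (hy : y.length = d) (hq : ∀ x ∈ u, x < q),
        y ⊆ u → c (subst (range p ++ Finset.univ.toList.flatMap block) (u ++ y)) =
          a fun i => ⟨u[i], hq _ (List.getElem_mem _)⟩ := by
      intro u y hu hy hq hyu
      have hx : ∀ e : Fin d, ∃ i : Fin p, u[i] = y[e] := by
        intro e
        obtain ⟨i, hi, h⟩ := List.getElem_of_mem (hyu (List.getElem_mem (by omega : e < y.length)))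
        exact ⟨⟨i, by omega⟩, h⟩
      choose x hx using hx
      rw [← congrFun (hl x)]
      congr 1
      rw [subst_append, subst_range_append hu]
      congr 1
      · apply List.ext_getElem <;> simp [hu]
      · rw [subst, List.map_flatMap]
        refine List.flatMap_congr fun i _ => ?_
        cases h : l.idxFun i with
        | none =>
          apply List.ext_getElem
          · simp [block, h]
          · intro e h1 h2
            have he : e < d := by simpa using h2
            have := hx ⟨e, he⟩
            simp only [Fin.getElem_fin] at this
            simp [block, h, List.getD, hu, hy, he, this]
        | some f =>
          apply List.ext_getElem
          · simp [block, h]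
          · intro e h1 h2
            have he : e < d := by simpa using h2
            simp [block, h, List.getD, List.getElem?_append_left, hu]
    intro u y y' hu hy hy' hq hyu hyu'
    rw [key u y hu hy hq hyu, key u y' hu hy' hq hyu']

lemma exists_rigid_forget_tails (κ : Type) [Finite κ] (q d t : ℕ) :
    ∃ n, ∀ c : List ℕ → κ, ∃ S : List ℕ, S.length = n ∧ IsRigid (t + d) (range t ++ S) ∧
      ∀ u y y' : List ℕ, t < u.length → (u ++ y).length = t + d → (u ++ y').length = t + d →
        (∀ x ∈ u, x < q) → y ⊆ u → y' ⊆ u →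
        c (subst (range t ++ S) (u ++ y)) = c (subst (range t ++ S) (u ++ y')) := by
  induction d generalizing t with
  | zero =>
    refine ⟨0, fun c => ⟨[], rfl, by simpa using .range t, fun u y y' h1 h2 => ?_⟩⟩
    simp at h2
    omega
  | succ d ih =>
    obtain ⟨d', hd'⟩ := ih (t + 1)
    obtain ⟨n, hn⟩ := exists_rigid_forget_tail κ q (t + 1) d'
    refine ⟨n + 1, fun c => ?_⟩
    obtain ⟨S₁, hS₁, hR₁, hc₁⟩ := hn c
    obtain ⟨S₂, hS₂, hR₂, hc₂⟩ := hd' fun w => c (subst (range (t + 1) ++ S₁) w)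
    set R₁ := range (t + 1) ++ S₁ with hR₁def
    set R₂ := range (t + 1) ++ S₂ with hR₂def
    have hlen : R₂.length = t + 1 + d' := by simp [hR₂def, hS₂]
    have hR : subst R₁ R₂ = range t ++ t :: subst S₁ R₂ := by
      rw [hR₁def, subst_append, hR₂def, subst_range_append (by simp), List.range_succ]
      simp
    have hcomp : ∀ B, subst (subst R₁ R₂) B = subst R₁ (subst R₂ B) := fun B =>
      subst_subst B (by rw [hlen]; exact hR₁.lt)
    refine ⟨t :: subst S₁ R₂, by simp [hS₁], ?_, ?_⟩
    · rw [← hR]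
      have := hR₁.subst hR₂ hlen
      rwa [add_right_comm] at this
    · intro u y y' hu hy hy' hq hyu hyu'
      rw [← hR, hcomp, hcomp]
      rcases Nat.lt_or_ge (t + 1) u.length with h | h
      · exact hc₂ u y y' h (by omega) (by omega) hq hyu hyu'
      · have hu' : u.length = t + 1 := by omega
        have hsub : ∀ y, (u ++ y).length = t + (d + 1) → y ⊆ u → subst S₂ (u ++ y) ⊆ u := by
          intro y hy hyu x hx
          have : x ∈ u ++ y := mem_of_mem_subst (fun i hi => by
            have := hR₂.lt i (by simp [hR₂def, hi])
            omega) hx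
          rcases List.mem_append.1 this with h | h
          exacts [h, hyu h]
        have hsubst : ∀ y, subst R₂ (u ++ y) = u ++ subst S₂ (u ++ y) := fun y => by
          rw [hR₂def, subst_append, subst_range_append hu']
        rw [hsubst, hsubst]
        exact hc₁ u _ _ hu' (by simp [hS₂]) (by simp [hS₂]) hq (hsub y hy hyu) (hsub y' hy' hyu')

/-- The dual Ramsey theorem for colorings of rigid surjections onto `{0, …, k - 1}`. -/
def HasDualRamsey (k : ℕ) : Prop :=
  ∀ (κ : Type) [Finite κ] (m : ℕ), ∃ n, ∀ c : List ℕ → κ, ∃ R : List ℕ, R.length = n ∧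
    IsRigid m R ∧ ∃ a, ∀ B, IsRigid k B → B.length = m → c (subst R B) = a

lemma HasDualRamsey.exists_rigid_before {k : ℕ} (hk : HasDualRamsey k) (κ : Type) [Finite κ]
    (m : ℕ) :
    ∃ n, ∀ c : List ℕ → κ, ∃ R : List ℕ, R.length = n ∧ IsRigid m R ∧ ∃ a : ℕ → κ,
      ∀ t < m, ∀ B, IsRigid k B → B.length = t → c (subst (before t R) B) = a t := by
  induction m with
  | zero => exact ⟨0, fun c => ⟨[], rfl, rfl, fun _ => c [], by simp⟩⟩
  | succ m ih =>
    obtain ⟨n', hn'⟩ := ih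
    obtain ⟨n, hn⟩ := hk κ n'
    refine ⟨n + 1, fun c => ?_⟩
    obtain ⟨R₁, hR₁n, hR₁, a₁, ha₁⟩ := hn c
    obtain ⟨R₂, hR₂n, hR₂, a₂, ha₂⟩ := hn' fun w => c (subst (before w.length R₁) w)
    have hR := hR₁.subst hR₂ hR₂n
    refine ⟨subst R₁ R₂ ++ [m], by simp [hR₁n], hR.snoc, fun t => if t = m then a₁ else a₂ t, ?_⟩
    rintro t ht B hB rfl
    rcases Nat.lt_succ_iff_lt_or_eq.1 ht with h | h
    · obtain ⟨⟨v, hv⟩, ht⟩ := hR₂.split h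
      have hs : (before B.length R₂).length < n' := by
        rw [← hR₂n]
        conv_rhs => rw [hv]
        simp
      simp only [h.ne, if_false]
      rw [hR.before_append h, hR₁.before_subst hR₂ hR₂n h,
        subst_subst B (hR₁.split hs).2.lt]
      simpa using ha₂ _ h B hB rfl
    · simp only [h, if_true]
      rw [hR.before_append_cons, subst_subst B (by rw [hR₂n]; exact hR₁.lt)]
      exact ha₁ _ (hR₂.subst hB h) (by simp [hR₂n])

lemma exists_rigid_before_mem {k M : ℕ} (hk : 0 < k) (hM : k ≤ M) (T : Finset ℕ)
    (hT : ∀ t ∈ T, k ≤ t ∧ t < M) :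
    ∃ R : List ℕ, R.length = M ∧ IsRigid (k + T.card) R ∧
      ∀ s, k ≤ s → s < k + T.card → (before s R).length ∈ T := by
  induction M, hM using Nat.le_induction generalizing T with
  | base =>
    obtain rfl : T = ∅ := Finset.eq_empty_of_forall_notMem fun t ht => by
      have := hT t ht
      omega
    exact ⟨range k, by simp, .range k, fun s h1 h2 => by simp at h2; omega⟩
  | succ M hM ih =>
    have key : ∀ T : Finset ℕ, (∀ t ∈ T, k ≤ t ∧ t < M + 1) → M ∉ T → ∀ t ∈ T, k ≤ t ∧ t < M := by
      intro T hT hMT t ht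
      have := hT t ht
      have : t ≠ M := fun h => hMT (h ▸ ht)
      omega
    by_cases hMT : M ∈ T
    · obtain ⟨R, hRM, hR, hRT⟩ := ih (T.erase M)
        (key _ (fun t ht => hT t (Finset.mem_of_mem_erase ht)) (by simp))
      have hcard := Finset.card_erase_add_one hMT
      refine ⟨R ++ [k + (T.erase M).card], by simp [hRM], ?_, fun s h1 h2 => ?_⟩
      · rw [← hcard, ← Nat.add_assoc]
        exact hR.snoc
      · rcases Nat.lt_or_ge s (k + (T.erase M).card) with h | h
        · rw [hR.before_append h]
          exact Finset.mem_of_mem_erase (hRT s h1 h)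
        · obtain rfl : s = k + (T.erase M).card := by omega
          rwa [hR.before_append_cons, hRM]
    · obtain ⟨R, hRM, hR, hRT⟩ := ih T (key T hT hMT)
      refine ⟨R ++ [0], by simp [hRM], hR.append (by simp; omega), fun s h1 h2 => ?_⟩
      rw [hR.before_append h2]
      exact hRT s h1 h2

lemma hasDualRamsey_zero : HasDualRamsey 0 := by
  refine fun κ _ m => ⟨m, fun c => ⟨range m, by simp, .range m, c [], ?_⟩⟩
  rintro B (rfl : B = []) rfl
  rfl

lemma hasDualRamsey_one : HasDualRamsey 1 := by
  refine fun κ _ m => ⟨m, fun c => ⟨range m, by simp, .range m, c (replicate m 0), ?_⟩⟩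
  rintro B hB rfl
  rw [subst_range_length, ← List.eq_replicate_length.2 fun b hb => by
    simpa using hB.lt b hb]

lemma HasDualRamsey.succ {k : ℕ} (h0 : 0 < k) (hk : HasDualRamsey k) : HasDualRamsey (k + 1) := by
  intro κ _ m
  have := Fintype.ofFinite κ
  classical
  rcases Nat.lt_or_ge m k with hmk | hmk
  · refine ⟨m, fun c => ⟨range m, by simp, .range m, c [], ?_⟩⟩
    rintro B hB rfl
    have := hB.le_length
    omega
  obtain ⟨M, hM⟩ := hk.exists_rigid_before κ (k + Fintype.card κ * (m - k))
  obtain ⟨n, hn⟩ := exists_rigid_forget_tails κ (k + 1) M 0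
  refine ⟨n, fun c => ?_⟩
  obtain ⟨R₁, hR₁n, hR₁, hc₁⟩ := hn c
  obtain ⟨R₂, hR₂n, hR₂, a, ha⟩ :=
    hM fun u => c (subst R₁ (u ++ k :: replicate (M - u.length - 1) k))
  simp only [Nat.zero_add, List.range_zero, List.nil_append] at hR₁ hc₁
  set M' := k + Fintype.card κ * (m - k)
  have : Nonempty κ := ⟨c []⟩
  obtain ⟨b, -, hb⟩ := Finset.exists_le_card_fiber_of_mul_le_card_of_maps_to
    (s := Finset.Ico k M') (t := Finset.univ) (f := a) (n := m - k) (by simp) (by simp)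
    (by simp [M', Finset.card_univ])
  obtain ⟨T, hTsub, hTcard⟩ := Finset.exists_subset_card_eq hb
  have hT : ∀ t ∈ T, (k ≤ t ∧ t < M') ∧ a t = b := by
    intro t ht
    simpa using hTsub ht
  obtain ⟨R₃, hR₃n, hR₃, hR₃T⟩ := exists_rigid_before_mem h0 (Nat.le_add_right _ _ : k ≤ M') T
    fun t ht => (hT t ht).1
  rw [hTcard, Nat.add_sub_cancel' hmk] at hR₃ hR₃T
  have hR₂₃ := hR₂.subst hR₃ hR₃n
  refine ⟨subst R₁ (subst R₂ R₃), by simp [hR₁n], hR₁.subst hR₂₃ (by simp [hR₂n]), b, ?_⟩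
  intro B hB hBm
  rw [subst_subst B (by simpa [hR₂n] using hR₁.lt),
    subst_subst B (by rw [hR₃n]; exact hR₂.lt)]
  have hB₃ := hR₃.subst hB hBm
  have hB₂ := hR₂.subst hB₃ (by rw [length_subst, hR₃n])
  obtain ⟨⟨v, hv⟩, hu⟩ := hB₂.split (Nat.lt_succ_self k)
  obtain ⟨⟨v₀, hv₀⟩, hu₀⟩ := hB.split (Nat.lt_succ_self k)
  have hu₃ := (hB₃.split (Nat.lt_succ_self k)).2
  have ht : (before k (subst R₃ B)).length ∈ T := by
    rw [hR₃.before_subst hB hBm (Nat.lt_succ_self k), length_subst]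
    refine hR₃T _ hu₀.le_length ?_
    rw [← hBm]
    conv_rhs => rw [hv₀]
    simp
  have hpre := hR₂.before_subst hB₃ (by rw [length_subst, hR₃n]) (Nat.lt_succ_self k)
  have hval := ha _ (hT _ ht).1.2 _ hu₃ rfl
  rw [← hpre, (hT _ ht).2] at hval
  rw [← hval]
  have hlen : (subst R₂ (subst R₃ B)).length = M := by simp [hR₂n]
  have hvlt := hB₂.lt
  set W := subst R₂ (subst R₃ B)
  set u := before k W
  rw [hv] at hlen hvlt ⊢
  have hall : ∀ x < k + 1, x ∈ u ++ [k] := by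
    intro x hx
    rcases Nat.lt_succ_iff_lt_or_eq.1 hx with h | rfl
    · simp [hu.mem h]
    · simp
  have := hc₁ (u ++ [k]) v (replicate (M - u.length - 1) k) (by simp)
    (by simpa using hlen) (by simp at hlen ⊢; omega)
    (fun x hx => hvlt x (by simp at hx ⊢; tauto)) (fun x hx => hall x (hvlt x (by simp [hx])))
    (fun x hx => by simp [List.eq_of_mem_replicate hx])
  simpa using this

lemma hasDualRamsey (k : ℕ) : HasDualRamsey k := by
  match k with
  | 0 => exact hasDualRamsey_zero
  | k + 1 =>
    induction k with
    | zero => exact hasDualRamsey_one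
    | succ k ih => exact ih.succ k.succ_pos

/-- The `n × k` matrix whose `i`-th row has its entry `1` in the column given by the `i`-th letter
of `w`. -/
def wordMatrix (n k : ℕ) (w : List ℕ) : Matrix (Fin n) (Fin k) ℕ :=
  fun i j => if w.getD i 0 = j then 1 else 0

lemma wordMatrix_apply_eq_one {n k : ℕ} {w : List ℕ} {i : Fin n} {j : Fin k} :
    wordMatrix n k w i j = 1 ↔ w.getD i 0 = j := by
  simp [wordMatrix]

lemma wordMatrix_mul {n m k : ℕ} {R B : List ℕ} (hR : ∀ x ∈ R, x < m) (hn : R.length = n) :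
    wordMatrix n m R * wordMatrix m k B = wordMatrix n k (subst R B) := by
  ext i j
  have hi : (i : ℕ) < R.length := by omega
  have hlt : R[(i : ℕ)] < m := hR _ (List.getElem_mem hi)
  have h : ∀ x : Fin m, R[(i : ℕ)] = x ↔ (⟨R[(i : ℕ)], hlt⟩ : Fin m) = x := fun x => by
    simp [Fin.ext_iff]
  simp [Matrix.mul_apply, wordMatrix, subst, List.getD, hi, h]
  congr

lemma IsRigid.isOrderedBooleanMatrix {n k : ℕ} {w : List ℕ} (hw : IsRigid k w)
    (hn : w.length = n) : IsOrderedBooleanMatrix (wordMatrix n k w) := by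
  have hget : ∀ i : Fin n, ∃ h : (i : ℕ) < w.length, w.getD i 0 = w[(i : ℕ)] := fun i =>
    have h : (i : ℕ) < w.length := by omega
    ⟨h, by simp [List.getD, h]⟩
  refine ⟨⟨fun i j => ?_, fun i => ?_, fun j => ?_⟩, fun j j' hjj' => ?_⟩
  · unfold wordMatrix
    split_ifs <;> simp
  · obtain ⟨h, hi⟩ := hget i
    refine ⟨⟨w[(i : ℕ)], hw.lt _ (List.getElem_mem h)⟩, wordMatrix_apply_eq_one.2 hi, ?_⟩
    intro j hj
    exact Fin.ext ((wordMatrix_apply_eq_one.1 hj).symm.trans hi)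
  · obtain ⟨i, h, hi⟩ := List.getElem_of_mem (hw.mem j.2)
    exact ⟨⟨i, by omega⟩, wordMatrix_apply_eq_one.2 (by simp [List.getD, h, hi])⟩
  · obtain ⟨⟨v, hv⟩, hu⟩ := hw.split j'.2
    set u := before j' w
    obtain ⟨i, h, hi⟩ := List.getElem_of_mem (hu.mem hjj')
    have hiw : i < w.length := by rw [hv, List.length_append]; omega
    refine ⟨⟨i, by omega⟩, wordMatrix_apply_eq_one.2 ?_, fun i' hi' => ?_⟩
    · change w.getD i 0 = j
      rw [hv]
      simp [List.getD, List.getElem?_append_left h, h, hi]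
    · rw [Fin.lt_def]
      by_contra! hle
      have h' : (i' : ℕ) < u.length := lt_of_le_of_lt hle h
      have h1 := wordMatrix_apply_eq_one.1 hi'
      rw [hv] at h1
      have h2 := hu.lt _ (List.getElem_mem h')
      simp [List.getD, List.getElem?_append_left h', h'] at h1
      omega

lemma _root_.IsOrderedBooleanMatrix.exists_isRigid {n k : ℕ} {A : Matrix (Fin n) (Fin k) ℕ}
    (hA : IsOrderedBooleanMatrix A) : ∃ w, w.length = n ∧ IsRigid k w ∧ A = wordMatrix n k w := by
  obtain ⟨⟨h01, hrow, hcol⟩, hord⟩ := hA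
  choose f hf hfu using hrow
  have hone : ∀ i j, A i j = 1 ↔ f i = j := fun i j =>
    ⟨fun h => (hfu i j h).symm, fun h => h ▸ hf i⟩
  refine ⟨ofFn fun i => (f i : ℕ), by simp, .of_forall_split (by simp [List.mem_ofFn]) ?_, ?_⟩
  · intro j hj
    have hex : ∃ i : Fin n, f i = ⟨j, hj⟩ := (hcol ⟨j, hj⟩).imp fun i hi => (hone _ _).1 hi
    classical
    obtain ⟨i, hi, hmin⟩ : ∃ i : Fin n, f i = ⟨j, hj⟩ ∧ ∀ i' < i, f i' ≠ ⟨j, hj⟩ :=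
      ⟨Fin.find _ hex, Fin.find_spec hex, fun i' h => Fin.find_min hex h⟩
    refine ⟨(ofFn fun i => (f i : ℕ)).take i, (ofFn fun i => (f i : ℕ)).drop (i + 1), ?_, ?_⟩
    · conv_lhs => rw [← List.take_append_drop i (ofFn fun i => (f i : ℕ)),
        List.drop_eq_getElem_cons (by simp)]
      simp [hi]
    · intro x hx
      obtain ⟨i', h', rfl⟩ := List.mem_take_iff_getElem.1 hx
      simp only [List.length_ofFn, lt_inf_iff] at h'
      rw [List.getElem_ofFn]
      by_contra! hle
      have hne := hmin ⟨i', h'.2⟩ h'.1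
      have hlt : (⟨j, hj⟩ : Fin k) < f ⟨i', h'.2⟩ :=
        lt_of_le_of_ne hle (Ne.symm hne)
      obtain ⟨i₀, h₀, h₁⟩ := hord _ _ hlt
      have h₂ := h₁ _ (hf ⟨i', h'.2⟩)
      exact hmin i₀ (h₂.trans h'.1) ((hone _ _).1 h₀)
  · ext i j
    have : wordMatrix n k (ofFn fun i => (f i : ℕ)) i j = if f i = j then 1 else 0 := by
      simp [wordMatrix, List.getD, Fin.ext_iff]
    rw [this]
    split_ifs with h
    · exact (hone i j).2 h
    · exact (h01 i j).resolve_right fun h1 => h ((hone i j).1 h1)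

lemma permMatrix_mul_permMatrix_inv {k : ℕ} (σ : Equiv.Perm (Fin k)) :
    permMatrix σ * permMatrix σ⁻¹ = 1 := by
  ext i j
  rw [Matrix.mul_apply, Finset.sum_eq_single (σ i)]
  · simp [permMatrix, Matrix.one_apply]
  · intro b _ hb
    simp [permMatrix, hb.symm]
  · simp

end DualRamsey

/-- Dual Ramsey Theorem, Boolean matrix form: for all `k, m, r` there is `n` such that for
every `r`-coloring of the `n × k` Boolean matrices there is an ordered Boolean `n × m`
matrix `R` such that the color of `R * B` depends only on `π(B)`, the unique permutation
with `B * π(B)` ordered, for all Boolean `m × k` matrices `B`. -/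
theorem dual_ramsey_boolean_matrices (k m r : ℕ) :
    ∃ n : ℕ, ∀ c : Matrix (Fin n) (Fin k) ℕ → Fin r,
      ∃ R : Matrix (Fin n) (Fin m) ℕ, IsOrderedBooleanMatrix R ∧
        ∀ (B B' : Matrix (Fin m) (Fin k) ℕ) (σ : Equiv.Perm (Fin k)),
          IsBooleanMatrix B → IsBooleanMatrix B' →
          IsOrderedBooleanMatrix (B * permMatrix σ) →
          IsOrderedBooleanMatrix (B' * permMatrix σ) →
          c (R * B) = c (R * B') := by
  obtain ⟨n, hn⟩ := DualRamsey.hasDualRamsey k (Equiv.Perm (Fin k) → Fin r) m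
  refine ⟨n, fun c => ?_⟩
  obtain ⟨R, hRn, hR, a, ha⟩ :=
    hn fun w τ => c (DualRamsey.wordMatrix n k w * permMatrix τ)
  have key : ∀ (B : Matrix (Fin m) (Fin k) ℕ) (σ : Equiv.Perm (Fin k)),
      IsOrderedBooleanMatrix (B * permMatrix σ) →
        c (DualRamsey.wordMatrix n m R * B) = a σ⁻¹ := by
    intro B σ hB
    obtain ⟨w, hwm, hw, hBw⟩ := hB.exists_isRigid
    rw [← ha w hw hwm, ← DualRamsey.wordMatrix_mul hR.lt hRn, ← hBw]
    dsimp only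
    rw [Matrix.mul_assoc, Matrix.mul_assoc, DualRamsey.permMatrix_mul_permMatrix_inv,
      Matrix.mul_one]
  exact ⟨DualRamsey.wordMatrix n m R, hR.isOrderedBooleanMatrix hRn,
    fun B B' σ _ _ hB hB' => (key B σ hB).trans (key B' σ hB').symm⟩
end

section
/- Let 𝔽 be a finite field. For all positive integers k, m, r there exists n such that for every r-coloring c of the set of n×k matrices of rank k over 𝔽, there is an n×m matrix R of rank m in reduced column echelon form such that the color c(R·A) depends only on τ(A), for every m×k matrix A of rank k; here τ(A) is the unique invertible k×k matrix such that A·τ(A) is in reduced column echelon form. -/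
/-- A full-rank `k × n` matrix is in reduced row echelon form. -/
def IsRREF {𝔽 : Type} [Field 𝔽] {k n : ℕ} (A : Matrix (Fin k) (Fin n) 𝔽) : Prop :=
  ∃ j : Fin k → Fin n, StrictMono j ∧
    (∀ i : Fin k, (fun i' => A i' (j i)) = Pi.single i 1) ∧
    ∀ i : Fin k,
      Submodule.span 𝔽 {v : Fin k → 𝔽 | ∃ l : Fin n, l < j i ∧ v = fun i' => A i' l} =
      Submodule.span 𝔽 {v : Fin k → 𝔽 | ∃ l : Fin k, l < i ∧ v = Pi.single l 1}

/-- A matrix is in reduced column echelon form when its transpose is in RREF. -/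
def IsRCEF {𝔽 : Type} [Field 𝔽] {n k : ℕ} (A : Matrix (Fin n) (Fin k) 𝔽) : Prop :=
  IsRREF A.transpose

open Module in
/-- `SubspaceArrow 𝔽 κ k a n` says that, whenever the subspaces of an `𝔽`-vector space of dimension
at least `n` are colored by `κ`, there are a color `i` and a subspace of dimension `a i` all of whose
`k`-dimensional subspaces have color `i`. -/
def SubspaceArrow (𝔽 κ : Type) [Field 𝔽] (k : ℕ) (a : κ → ℕ) (n : ℕ) : Prop :=
  ∀ (V : Type) [AddCommGroup V] [Module 𝔽 V] [FiniteDimensional 𝔽 V], n ≤ finrank 𝔽 V →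
    ∀ c : Submodule 𝔽 V → κ, ∃ i, ∃ W : Submodule 𝔽 V, finrank 𝔽 W = a i ∧
      ∀ S ≤ W, finrank 𝔽 S = k → c S = i

section Hyperplane

variable {𝔽 E V : Type} [Field 𝔽] [AddCommGroup E] [Module 𝔽 E] [AddCommGroup V] [Module 𝔽 V]
  {φ : E →ₗ[𝔽] V} {e : V}

theorem eq_zero_of_map_add_smul_eq_zero (hφ : Function.Injective φ) (he : e ∉ LinearMap.range φ)
    {x : E} {t : 𝔽} (h : φ x + t • e = 0) : x = 0 ∧ t = 0 := by
  have ht : t = 0 := by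
    by_contra ht
    refine he ⟨-(t⁻¹ • x), ?_⟩
    have : t • e = -φ x := (neg_eq_of_add_eq_zero_right h).symm
    rw [map_neg, map_smul, ← smul_neg, ← this, smul_smul, inv_mul_cancel₀ ht, one_smul]
  subst ht
  exact ⟨hφ (by simpa using h), rfl⟩

theorem mem_of_map_add_smul_mem (hφ : Function.Injective φ) (he : e ∉ LinearMap.range φ)
    {W : Submodule 𝔽 E} {x : E} {t : 𝔽}
    (h : φ x + t • e ∈ W.map φ ⊔ Submodule.span 𝔽 {e}) : x ∈ W := by
  obtain ⟨_, ⟨w, hw, rfl⟩, _, hz, hs⟩ := Submodule.mem_sup.1 h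
  obtain ⟨s, rfl⟩ := Submodule.mem_span_singleton.1 hz
  have h0 : φ (x - w) + (t - s) • e = 0 := by
    rw [map_sub, sub_smul, ← sub_eq_zero.2 hs.symm]
    abel
  rw [sub_eq_zero.1 (eq_zero_of_map_add_smul_eq_zero hφ he h0).1]
  exact hw

theorem injective_add_smulRight (hφ : Function.Injective φ) (he : e ∉ LinearMap.range φ)
    (g : E →ₗ[𝔽] 𝔽) : Function.Injective (φ + g.smulRight e) := by
  rw [injective_iff_map_eq_zero]
  intro x hx
  exact (eq_zero_of_map_add_smul_eq_zero hφ he (by simpa using hx)).1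

theorem exists_eq_map_add_smulRight {S : Submodule 𝔽 V}
    (hS : S ≤ LinearMap.range φ ⊔ Submodule.span 𝔽 {e}) (heS : e ∉ S) :
    ∃ (T : Submodule 𝔽 E) (g : E →ₗ[𝔽] 𝔽), S = T.map (φ + g.smulRight e) := by
  let Ψ : E × 𝔽 →ₗ[𝔽] V := φ.coprod (LinearMap.toSpanSingleton 𝔽 V e)
  have hΨ (x : E) (t : 𝔽) : Ψ (x, t) = φ x + t • e := by simp [Ψ]
  let P : Submodule 𝔽 (E × 𝔽) := S.comap Ψ
  let π : P →ₗ[𝔽] E := LinearMap.fst 𝔽 E 𝔽 ∘ₗ P.subtype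
  have hπ : LinearMap.ker π = ⊥ := by
    rw [LinearMap.ker_eq_bot']
    rintro ⟨⟨x, t⟩, hxt⟩ (rfl : x = 0)
    have h : t • e ∈ S := by simpa [P, hΨ] using hxt
    have ht : t = 0 := by
      by_contra ht
      exact heS ((S.smul_mem_iff ht).1 h)
    simp [ht]
  obtain ⟨f, hf⟩ := LinearMap.exists_leftInverse_of_injective π hπ
  refine ⟨LinearMap.range π, LinearMap.snd 𝔽 E 𝔽 ∘ₗ P.subtype ∘ₗ f, ?_⟩
  have key (p : P) : (φ + (LinearMap.snd 𝔽 E 𝔽 ∘ₗ P.subtype ∘ₗ f).smulRight e) (π p) = Ψ p := by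
    have hp : f (π p) = p := LinearMap.congr_fun hf p
    obtain ⟨⟨x, t⟩, hxt⟩ := p
    change f x = _ at hp
    simp [hp, hΨ, π]
  apply le_antisymm
  · intro s hs
    obtain ⟨_, ⟨x, rfl⟩, _, hz, rfl⟩ := Submodule.mem_sup.1 (hS hs)
    obtain ⟨t, rfl⟩ := Submodule.mem_span_singleton.1 hz
    have hp : (x, t) ∈ P := by simpa [P, hΨ] using hs
    exact ⟨π ⟨_, hp⟩, ⟨_, rfl⟩, by rw [key, ← hΨ]⟩
  · rintro _ ⟨_, ⟨p, rfl⟩, rfl⟩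
    rw [key]
    exact p.2

theorem finrank_map_sup_span_singleton [FiniteDimensional 𝔽 E] (hφ : Function.Injective φ)
    (he : e ∉ LinearMap.range φ) (T : Submodule 𝔽 E) :
    Module.finrank 𝔽 ↥(T.map φ ⊔ Submodule.span 𝔽 {e}) = Module.finrank 𝔽 T + 1 := by
  have he0 : e ≠ 0 := by
    rintro rfl
    exact he (zero_mem _)
  have hd : T.map φ ⊓ Submodule.span 𝔽 {e} = ⊥ := by
    rw [← disjoint_iff, Submodule.disjoint_span_singleton' he0]
    exact fun h => he (LinearMap.map_le_range h)
  have h := Submodule.finrank_sup_add_finrank_inf_eq (T.map φ) (Submodule.span 𝔽 {e})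
  rw [hd, finrank_bot, add_zero, finrank_span_singleton he0,
    ← (Submodule.equivMapOfInjective φ hφ T).finrank_eq] at h
  exact h

theorem eq_map_comap_sup_span_singleton {S : Submodule 𝔽 V}
    (hS : S ≤ LinearMap.range φ ⊔ Submodule.span 𝔽 {e}) (heS : e ∈ S) :
    S = (S.comap φ).map φ ⊔ Submodule.span 𝔽 {e} := by
  apply le_antisymm
  · intro s hs
    obtain ⟨_, ⟨x, rfl⟩, z, hz, rfl⟩ := Submodule.mem_sup.1 (hS hs)
    have hzS : z ∈ S := (Submodule.span_singleton_le_iff_mem e S).2 heS hz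
    exact Submodule.add_mem_sup ⟨x, (S.add_mem_iff_left hzS).1 hs, rfl⟩ hz
  · exact sup_le (Submodule.map_comap_le φ S) ((Submodule.span_singleton_le_iff_mem e S).2 heS)

end Hyperplane

open Module in
/-- A consequence of the Hales–Jewett theorem: there are an embedding `φ` of `𝔽 ^ u` and a direction
`e` transverse to its image such that shearing a subspace along `e` does not change its color. -/
theorem exists_shear_invariant (𝔽 κ : Type) [Field 𝔽] [Finite 𝔽] [Finite κ] (u : ℕ) :
    ∃ n : ℕ, ∀ (V : Type) [AddCommGroup V] [Module 𝔽 V] [FiniteDimensional 𝔽 V],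
      n ≤ finrank 𝔽 V → ∀ c : Submodule 𝔽 V → κ,
        ∃ (φ : (Fin u → 𝔽) →ₗ[𝔽] V) (e : V), Function.Injective φ ∧ e ∉ LinearMap.range φ ∧
          ∀ (T : Submodule 𝔽 (Fin u → 𝔽)) (g : (Fin u → 𝔽) →ₗ[𝔽] 𝔽),
            c (T.map (φ + g.smulRight e)) = c (T.map φ) := by
  classical
  have : Finite ((Fin u → 𝔽) →ₗ[𝔽] 𝔽) := Finite.of_injective _ DFunLike.coe_injective
  have : Finite (Submodule 𝔽 (Fin u → 𝔽)) := Finite.of_injective _ SetLike.coe_injective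
  obtain ⟨ι, _, hι⟩ := Combinatorics.Line.exists_mono_in_high_dimension
    ((Fin u → 𝔽) →ₗ[𝔽] 𝔽) (Submodule 𝔽 (Fin u → 𝔽) → κ)
  refine ⟨Fintype.card (Fin u ⊕ ι), fun V _ _ _ hV c => ?_⟩
  obtain ⟨b, hb⟩ := exists_linearIndependent_of_le_finrank hV
  replace hb := hb.comp _ (Fintype.equivFin (Fin u ⊕ ι)).injective
  set b' := b ∘ Fintype.equivFin (Fin u ⊕ ι)
  let Φ : (Fin u ⊕ ι → 𝔽) →ₗ[𝔽] V := Fintype.linearCombination 𝔽 b'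
  have hΦ : Function.Injective Φ := hb.fintypeLinearCombination_injective
  let emb (w : ι → (Fin u → 𝔽) →ₗ[𝔽] 𝔽) : (Fin u → 𝔽) →ₗ[𝔽] (Fin u ⊕ ι → 𝔽) :=
    LinearMap.pi (Sum.elim (fun j => LinearMap.proj j) w)
  obtain ⟨l, d, hd⟩ := hι (fun w T => c (T.map (Φ ∘ₗ emb w)))
  let v : Fin u ⊕ ι → 𝔽 := Sum.elim 0 (fun i => if l.idxFun i = none then 1 else 0)
  have hline (g : (Fin u → 𝔽) →ₗ[𝔽] 𝔽) :
      Φ ∘ₗ emb (l 0) + g.smulRight (Φ v) = Φ ∘ₗ emb (l g) := by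
    apply LinearMap.ext
    intro x
    simp only [LinearMap.add_apply, LinearMap.comp_apply, LinearMap.smulRight_apply, ← map_smul,
      ← map_add]
    congr 1
    ext (j | i)
    · simp [emb, v]
    · cases h : l.idxFun i <;> simp [emb, v, h]
  refine ⟨Φ ∘ₗ emb (l 0), Φ v, ?_, ?_, fun T g => ?_⟩
  · refine hΦ.comp fun x y h => funext fun j => ?_
    exact congrFun h (Sum.inl j)
  · rintro ⟨x, hx⟩
    have h : emb (l 0) x = v := hΦ hx
    have hx0 : x = 0 := funext fun j => congrFun h (Sum.inl j)
    obtain ⟨i, hi⟩ := l.proper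
    have := congrFun h (Sum.inr i)
    simp [hx0, v, hi] at this
  · rw [hline]
    exact congrFun ((hd g).trans (hd 0).symm) T

open Module in
theorem exists_submodule_finrank_eq {𝔽 V : Type} [Field 𝔽] [AddCommGroup V] [Module 𝔽 V]
    [FiniteDimensional 𝔽 V] {m : ℕ} (h : m ≤ finrank 𝔽 V) :
    ∃ W : Submodule 𝔽 V, finrank 𝔽 W = m := by
  obtain ⟨b, hb⟩ := exists_linearIndependent_of_le_finrank h
  exact ⟨Submodule.span 𝔽 (Set.range b), by simpa using finrank_span_eq_card hb⟩

open Module in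
theorem exists_subspaceArrow_succ {𝔽 κ : Type} [Field 𝔽] [Finite 𝔽] [Finite κ] {k : ℕ}
    (hk : ∀ m, ∃ n, SubspaceArrow 𝔽 κ k (fun _ => m) n) (a : κ → ℕ) :
    ∃ n, SubspaceArrow 𝔽 κ (k + 1) a n := by
  classical
  have := Fintype.ofFinite κ
  induction hs : ∑ i, a i using Nat.strong_induction_on generalizing a with
  | _ s ih =>
    by_cases h0 : ∃ i, a i = 0
    · obtain ⟨i, hi⟩ := h0
      refine ⟨0, fun V _ _ _ _ c => ⟨i, ⊥, by simp [hi], fun S hS hS' => ?_⟩⟩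
      rw [le_bot_iff.1 hS, finrank_bot] at hS'
      omega
    push Not at h0
    have hlower (j : κ) : ∃ n, SubspaceArrow 𝔽 κ (k + 1) (Function.update a j (a j - 1)) n := by
      refine ih _ ?_ _ rfl
      rw [← hs]
      refine Finset.sum_lt_sum (fun i _ => ?_) ⟨j, Finset.mem_univ j, ?_⟩
      · rcases eq_or_ne i j with rfl | hij
        · simp
        · simp [hij]
      · have := h0 j
        simp
        omega
    choose N hN using hlower
    obtain ⟨u, hu⟩ := hk (∑ j, N j)
    obtain ⟨n, hn⟩ := exists_shear_invariant 𝔽 κ u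
    refine ⟨n, fun V _ _ _ hV c => ?_⟩
    obtain ⟨φ, e, hφ, he, hshear⟩ := hn V hV c
    obtain ⟨j, W₀, hW₀, hj⟩ := hu (Fin u → 𝔽) (by simp)
      (fun T => c (T.map φ ⊔ Submodule.span 𝔽 {e}))
    obtain ⟨i, W₁, hW₁, hi⟩ := hN j W₀
      (hW₀.symm ▸ Finset.single_le_sum (f := N) (fun _ _ => Nat.zero_le _) (Finset.mem_univ j))
      (fun T => c ((T.map W₀.subtype).map φ))
    let W := W₁.map W₀.subtype
    have hWW₀ : W ≤ W₀ := Submodule.map_subtype_le W₀ W₁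
    have hWrank : finrank 𝔽 W = Function.update a j (a j - 1) i := by
      rw [← hW₁]
      exact Submodule.finrank_map_subtype_eq W₀ W₁
    have hW (T : Submodule 𝔽 (Fin u → 𝔽)) (hT : T ≤ W) (hT' : finrank 𝔽 T = k + 1) :
        c (T.map φ) = i := by
      have hTW₀ : (T.comap W₀.subtype).map W₀.subtype = T := by
        rw [Submodule.map_comap_subtype, inf_eq_right.2 (hT.trans hWW₀)]
      rw [← hTW₀]
      refine hi _ ?_ ?_
      · rw [← Submodule.comap_map_eq_of_injective W₀.injective_subtype W₁]
        exact Submodule.comap_mono hT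
      · rw [← hT', ← Submodule.finrank_map_subtype_eq, hTW₀]
    by_cases hij : i = j
    · subst hij
      refine ⟨i, W.map φ ⊔ Submodule.span 𝔽 {e}, ?_, fun S hS hSk => ?_⟩
      · rw [finrank_map_sup_span_singleton hφ he, hWrank, Function.update_self]
        have := h0 i
        omega
      have hS' : S ≤ LinearMap.range φ ⊔ Submodule.span 𝔽 {e} :=
        hS.trans (sup_le_sup_right LinearMap.map_le_range _)
      by_cases heS : e ∈ S
      · have hST := eq_map_comap_sup_span_singleton hS' heS
        rw [hST] at hSk ⊢
        rw [finrank_map_sup_span_singleton hφ he] at hSk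
        refine hj _ (fun x hx => hWW₀ ?_) (by omega)
        exact mem_of_map_add_smul_mem hφ he (t := 0) (by simpa using hS hx)
      · obtain ⟨T, g, rfl⟩ := exists_eq_map_add_smulRight hS' heS
        rw [hshear]
        refine hW T (fun x hx => ?_) ?_
        · exact mem_of_map_add_smul_mem hφ he (t := g x) (hS ⟨x, hx, by simp⟩)
        · rw [← hSk]
          exact (Submodule.equivMapOfInjective _ (injective_add_smulRight hφ he g) T).finrank_eq
    · refine ⟨i, W.map φ, ?_, fun S hS hSk => ?_⟩
      · rw [← (Submodule.equivMapOfInjective φ hφ W).finrank_eq, hWrank,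
          Function.update_of_ne hij]
      · have hST : (S.comap φ).map φ = S :=
          Submodule.map_comap_eq_of_le (hS.trans LinearMap.map_le_range)
        rw [← hST]
        refine hW _ ?_ ?_
        · rw [← Submodule.comap_map_eq_of_injective hφ W]
          exact Submodule.comap_mono hS
        · rw [← hSk, (Submodule.equivMapOfInjective φ hφ (S.comap φ)).finrank_eq, hST]

open Module in
/-- The **Graham–Leeb–Rothschild theorem** for linear subspaces over a finite field. -/
theorem exists_subspaceArrow (𝔽 κ : Type) [Field 𝔽] [Finite 𝔽] [Finite κ] (k m : ℕ) :
    ∃ n, SubspaceArrow 𝔽 κ k (fun _ => m) n := by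
  induction k generalizing m with
  | zero =>
    refine ⟨m, fun V _ _ _ hV c => ?_⟩
    obtain ⟨W, hW⟩ := exists_submodule_finrank_eq hV
    exact ⟨c ⊥, W, hW, fun S _ hS => by rw [Submodule.finrank_eq_zero.1 hS]⟩
  | succ k ih => exact exists_subspaceArrow_succ ih _

section EchelonForm

variable {𝔽 : Type} [Field 𝔽] {k m n : ℕ}

/-- `M` is in reduced row echelon form, its `i`-th row having its pivot in column `j i`. -/
structure HasPivots (M : Matrix (Fin k) (Fin n) 𝔽) (j : Fin k → Fin n) : Prop where
  strictMono : StrictMono j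
  apply_pivot : ∀ i i', M i' (j i) = (1 : Matrix (Fin k) (Fin k) 𝔽) i' i
  apply_eq_zero : ∀ i l, l < j i → M i l = 0

theorem isRREF_iff_exists_hasPivots {M : Matrix (Fin k) (Fin n) 𝔽} :
    IsRREF M ↔ ∃ j, HasPivots M j := by
  constructor
  · rintro ⟨j, hj, hp, hs⟩
    refine ⟨j, hj, fun i i' => ?_, fun i l hl => ?_⟩
    · rw [congrFun (hp i) i', Matrix.one_apply, Pi.single_apply]
    · have hmem : (fun i' => M i' l) ∈
          Submodule.span 𝔽 {v : Fin k → 𝔽 | ∃ l : Fin k, l < i ∧ v = Pi.single l 1} :=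
        hs i ▸ Submodule.subset_span ⟨l, hl, rfl⟩
      have hle : Submodule.span 𝔽 {v : Fin k → 𝔽 | ∃ l : Fin k, l < i ∧ v = Pi.single l 1} ≤
          LinearMap.ker (LinearMap.proj (R := 𝔽) (φ := fun _ : Fin k => 𝔽) i) := by
        rw [Submodule.span_le]
        rintro _ ⟨l', hl', rfl⟩
        simp [hl'.ne']
      exact hle hmem
  · rintro ⟨j, hj, hp, hz⟩
    have hcol (i : Fin k) : (fun i' => M i' (j i)) = Pi.single i 1 := by
      ext i'
      rw [hp, Matrix.one_apply, Pi.single_apply]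
    refine ⟨j, hj, hcol, fun i => le_antisymm ?_ ?_⟩ <;> rw [Submodule.span_le]
    · rintro _ ⟨l, hl, rfl⟩
      rw [← Finset.univ_sum_single (fun i' => M i' l)]
      refine Submodule.sum_mem _ fun i' _ => ?_
      rcases lt_or_ge i' i with h | h
      · rw [← mul_one (M i' l), ← smul_eq_mul, Pi.single_smul]
        exact Submodule.smul_mem _ _ (Submodule.subset_span ⟨i', h, rfl⟩)
      · rw [hz i' l (hl.trans_le (hj.monotone h)), Pi.single_zero]
        exact zero_mem _
    · rintro _ ⟨l, hl, rfl⟩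
      exact Submodule.subset_span ⟨j l, hj hl, (hcol l).symm⟩

namespace HasPivots

theorem mul {B : Matrix (Fin k) (Fin m) 𝔽} {R : Matrix (Fin m) (Fin n) 𝔽} {j : Fin k → Fin m}
    {p : Fin m → Fin n} (hB : HasPivots B j) (hR : HasPivots R p) : HasPivots (B * R) (p ∘ j) where
  strictMono := hR.strictMono.comp hB.strictMono
  apply_pivot i i' := by
    rw [Matrix.mul_apply, ← hB.apply_pivot]
    simp [hR.apply_pivot, Matrix.one_apply]
  apply_eq_zero i l hl := by
    rw [Matrix.mul_apply]
    refine Finset.sum_eq_zero fun x _ => ?_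
    rcases lt_or_ge x (j i) with h | h
    · rw [hB.apply_eq_zero i x h, zero_mul]
    · rw [hR.apply_eq_zero x l (hl.trans_le (hR.strictMono.monotone h)), mul_zero]

variable {M : Matrix (Fin k) (Fin n) 𝔽} {j : Fin k → Fin n}

theorem sum_pivot_smul (h : HasPivots M j) {v : Fin n → 𝔽}
    (hv : v ∈ Submodule.span 𝔽 (Set.range M.row)) : ∑ i, v (j i) • M i = v := by
  obtain ⟨x, rfl⟩ := (Submodule.mem_span_range_iff_exists_fun 𝔽).1 hv
  refine Finset.sum_congr rfl fun i _ => ?_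
  congr 1
  simp [h.apply_pivot, Matrix.one_apply]

theorem linearIndependent (h : HasPivots M j) : LinearIndependent 𝔽 M.row := by
  rw [Fintype.linearIndependent_iff]
  intro g hg i
  have := congrFun hg (j i)
  simpa [h.apply_pivot, Matrix.one_apply] using this

theorem mem_range_pivots_iff (h : HasPivots M j) {l : Fin n} :
    l ∈ Set.range j ↔
      ∃ v ∈ Submodule.span 𝔽 (Set.range M.row), v l ≠ 0 ∧ ∀ l' < l, v l' = 0 := by
  constructor
  · rintro ⟨i, rfl⟩
    exact ⟨M i, Submodule.subset_span ⟨i, rfl⟩, by simp [h.apply_pivot],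
      fun l' => h.apply_eq_zero i l'⟩
  · rintro ⟨v, hv, hl, hlt⟩
    by_contra hj
    refine hl ?_
    rw [← h.sum_pivot_smul hv, Finset.sum_apply]
    refine Finset.sum_eq_zero fun i _ => ?_
    rw [Pi.smul_apply]
    rcases lt_trichotomy (j i) l with hi | hi | hi
    · rw [hlt _ hi, zero_smul]
    · exact absurd ⟨i, hi⟩ hj
    · rw [h.apply_eq_zero i l hi, smul_zero]

theorem eq_of_span_eq (h : HasPivots M j) {M' : Matrix (Fin k) (Fin n) 𝔽} {j' : Fin k → Fin n}
    (h' : HasPivots M' j')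
    (hs : Submodule.span 𝔽 (Set.range M.row) = Submodule.span 𝔽 (Set.range M'.row)) : M = M' := by
  have hj : j = j' := by
    apply (h.strictMono.range_inj h'.strictMono).1
    ext l
    rw [h.mem_range_pivots_iff, h'.mem_range_pivots_iff, hs]
  subst hj
  funext i
  have hi : M i ∈ Submodule.span 𝔽 (Set.range M'.row) := hs ▸ Submodule.subset_span ⟨i, rfl⟩
  rw [← h'.sum_pivot_smul hi]
  simp only [h.apply_pivot, Matrix.one_apply, ite_smul, one_smul, zero_smul]
  exact Finset.sum_ite_eq Finset.univ i M' |>.trans (if_pos (Finset.mem_univ i))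

end HasPivots

theorem exists_leading_index {v : Fin n → 𝔽} (hv : v ≠ 0) :
    ∃ l, v l ≠ 0 ∧ ∀ l' < l, v l' = 0 := by
  classical
  have hne : (Finset.univ.filter fun l => v l ≠ 0).Nonempty := by
    obtain ⟨l, hl⟩ := Function.ne_iff.1 hv
    exact ⟨l, by simpa using hl⟩
  refine ⟨_, (Finset.mem_filter.1 (Finset.min'_mem _ hne)).2, fun l' hl' => ?_⟩
  by_contra h
  exact absurd (Finset.min'_le _ l' (by simpa using h)) (not_le.2 hl')

theorem exists_hasPivots_span_eq (S : Submodule 𝔽 (Fin n → 𝔽)) (hS : Module.finrank 𝔽 S = k) :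
    ∃ (M : Matrix (Fin k) (Fin n) 𝔽) (j : Fin k → Fin n),
      HasPivots M j ∧ Submodule.span 𝔽 (Set.range M.row) = S := by
  classical
  let P : Finset (Fin n) := Finset.univ.filter fun l => ∃ v ∈ S, v l ≠ 0 ∧ ∀ l' < l, v l' = 0
  have hP {v : Fin n → 𝔽} (hv : v ∈ S) {l : Fin n} (hl : v l ≠ 0) (hlt : ∀ l' < l, v l' = 0) :
      l ∈ P := by
    simp only [P, Finset.mem_filter, Finset.mem_univ, true_and]
    exact ⟨v, hv, hl, hlt⟩
  let ρ : S →ₗ[𝔽] (P → 𝔽) := LinearMap.funLeft 𝔽 𝔽 (fun p : P => (p : Fin n)) ∘ₗ S.subtype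
  have hρ : Function.Injective ρ := by
    rw [injective_iff_map_eq_zero]
    intro v hv
    by_contra hv0
    obtain ⟨l, hl, hlt⟩ := exists_leading_index (v := (v : Fin n → 𝔽)) (by simpa using hv0)
    exact hl (congrFun hv ⟨l, hP v.2 hl hlt⟩)
  have hlead (p : P) :
      ∃ v : S, (v : Fin n → 𝔽) p ≠ 0 ∧ ∀ l' < (p : Fin n), (v : Fin n → 𝔽) l' = 0 := by
    obtain ⟨v, hv, h⟩ := (Finset.mem_filter.1 p.2).2
    exact ⟨⟨v, hv⟩, h⟩
  choose w hw hw0 using hlead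
  have hindep : LinearIndependent 𝔽 w := by
    rw [Fintype.linearIndependent_iff]
    intro g hg
    by_contra! hne
    have hne' : (Finset.univ.filter fun p => g p ≠ 0).Nonempty := by
      obtain ⟨p, hp⟩ := hne
      exact ⟨p, by simpa using hp⟩
    obtain ⟨p, hp, hmin⟩ := Finset.exists_minimal hne'
    have hzero := congrFun (congrArg Subtype.val hg) (p : Fin n)
    simp only [Submodule.coe_sum, Submodule.coe_smul, Finset.sum_apply, Pi.smul_apply,
      smul_eq_mul] at hzero
    rw [Finset.sum_eq_single p] at hzero
    · exact (mul_ne_zero (Finset.mem_filter.1 hp).2 (hw p)) hzero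
    · intro q _ hqp
      rcases lt_or_gt_of_ne hqp with h | h
      · have hq : g q = 0 := by
          by_contra hq
          exact absurd (hmin (Finset.mem_filter.2 ⟨Finset.mem_univ q, hq⟩) h.le) (not_le.2 h)
        rw [hq, zero_mul]
      · rw [hw0 q p h, mul_zero]
    · simp
  have hcard : P.card = k := by
    apply le_antisymm
    · simpa [hS] using hindep.fintype_card_le_finrank
    · simpa [hS] using LinearMap.finrank_le_finrank_of_injective hρ
  have hsurj : Function.Surjective ρ := by
    refine (LinearMap.injective_iff_surjective_of_finrank_eq_finrank ?_).1 hρ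
    simp [hS, hcard]
  choose f hf using hsurj
  let j := P.orderEmbOfFin hcard
  have hjP (i : Fin k) : j i ∈ P := P.orderEmbOfFin_mem hcard i
  let b (i : Fin k) : S := f (Pi.single ⟨j i, hjP i⟩ 1)
  have hb (i : Fin k) (p : Fin n) (hp : p ∈ P) :
      (b i : Fin n → 𝔽) p = (Pi.single ⟨j i, hjP i⟩ 1 : P → 𝔽) ⟨p, hp⟩ :=
    congrFun (hf (Pi.single ⟨j i, hjP i⟩ 1)) ⟨p, hp⟩
  have hM : HasPivots (fun i => (b i : Fin n → 𝔽)) j := by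
    refine ⟨j.strictMono, fun i i' => ?_, fun i l hl => ?_⟩
    · rw [hb i' _ (hjP i), Matrix.one_apply, Pi.single_apply]
      simp [eq_comm]
    · have hb0 : (b i : Fin n → 𝔽) ≠ 0 := fun h => by
        have := hb i _ (hjP i)
        simp [h] at this
      obtain ⟨l', hl', hlt⟩ := exists_leading_index hb0
      have hl'P := hP (b i).2 hl' hlt
      have : l' = j i := by
        rw [hb i _ hl'P, Pi.single_apply] at hl'
        simpa using hl'
      exact hlt l (this ▸ hl)
  refine ⟨_, j, hM, Submodule.eq_of_le_of_finrank_eq ?_ ?_⟩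
  · rw [Submodule.span_le]
    rintro _ ⟨i, rfl⟩
    exact (b i).2
  · rw [finrank_span_eq_card hM.linearIndependent, Fintype.card_fin, hS]

end EchelonForm

/-- Factorization of colorings of full-rank matrices over a finite field: for all positive
`k, m, r` there is `n` such that for every `r`-coloring `c` of the rank-`k` `n × k` matrices
over `𝔽` there is a rank-`m` matrix `R ∈ E_{n,m}(𝔽)` in RCEF such that the color `c (R * A)`
depends only on `τ(A)`, the unique invertible `k × k` matrix with `A * τ(A)` in RCEF. -/
theorem factorization_full_rank_matrices_finite_field
    (𝔽 : Type) [Field 𝔽] [Fintype 𝔽] (k m r : ℕ) (hk : 0 < k) (hm : 0 < m) (hr : 0 < r) :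
    ∃ n : ℕ, ∀ c : Matrix (Fin n) (Fin k) 𝔽 → Fin r,
      ∃ R : Matrix (Fin n) (Fin m) 𝔽, R.rank = m ∧ IsRCEF R ∧
        ∀ (A A' : Matrix (Fin m) (Fin k) 𝔽) (τ : Matrix (Fin k) (Fin k) 𝔽),
          A.rank = k → A'.rank = k → IsUnit τ →
          IsRCEF (A * τ) → IsRCEF (A' * τ) →
          c (R * A) = c (R * A') := by
  classical
  obtain ⟨n, hn⟩ := exists_subspaceArrow 𝔽 (Matrix (Fin k) (Fin k) 𝔽 → Fin r) k m
  refine ⟨n, fun c => ?_⟩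
  let color (S : Submodule 𝔽 (Fin n → 𝔽)) (τ : Matrix (Fin k) (Fin k) 𝔽) : Fin r :=
    if hS : Module.finrank 𝔽 S = k then c ((exists_hasPivots_span_eq S hS).choose.transpose * τ⁻¹)
    else ⟨0, hr⟩
  have hcolor (M : Matrix (Fin k) (Fin n) 𝔽) (j : Fin k → Fin n) (hM : HasPivots M j)
      (τ : Matrix (Fin k) (Fin k) 𝔽) :
      color (Submodule.span 𝔽 (Set.range M.row)) τ = c (M.transpose * τ⁻¹) := by
    have hS : Module.finrank 𝔽 (Submodule.span 𝔽 (Set.range M.row)) = k := by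
      rw [finrank_span_eq_card hM.linearIndependent, Fintype.card_fin]
    simp only [color, dif_pos hS]
    obtain ⟨j', hM', hs⟩ := (exists_hasPivots_span_eq _ hS).choose_spec
    rw [hM'.eq_of_span_eq hM hs]
  obtain ⟨d, W, hW, hd⟩ := hn (Fin n → 𝔽) (by simp) color
  beta_reduce at hW
  obtain ⟨N, p, hN, hNW⟩ := exists_hasPivots_span_eq W hW
  have hred (A : Matrix (Fin m) (Fin k) 𝔽) (τ : Matrix (Fin k) (Fin k) 𝔽) (hτ : IsUnit τ)
      (hA : IsRCEF (A * τ)) : c (N.transpose * A) = d τ := by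
    obtain ⟨j, hj⟩ := isRREF_iff_exists_hasPivots.1 hA
    have hBN := hj.mul hN
    have hle : Submodule.span 𝔽 (Set.range ((A * τ).transpose * N).row) ≤ W := by
      rw [Submodule.span_le]
      rintro _ ⟨i, rfl⟩
      rw [← hNW]
      refine (Submodule.mem_span_range_iff_exists_fun 𝔽).2 ⟨(A * τ).transpose i, ?_⟩
      ext l
      simp only [Finset.sum_apply, Pi.smul_apply, smul_eq_mul, Matrix.row_apply, Matrix.mul_apply]
    rw [← hd _ hle (by rw [finrank_span_eq_card hBN.linearIndependent, Fintype.card_fin]),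
      hcolor _ _ hBN]
    congr 1
    rw [Matrix.transpose_mul _ N, Matrix.transpose_transpose, ← Matrix.mul_assoc, Matrix.mul_assoc,
      Matrix.mul_nonsing_inv _ ((Matrix.isUnit_iff_isUnit_det τ).1 hτ), Matrix.mul_one]
  refine ⟨N.transpose, ?_, ?_, fun A A' τ _ _ hτ hA hA' => ?_⟩
  · rw [Matrix.rank_eq_finrank_span_cols, Matrix.col_transpose]
    exact hNW ▸ hW
  · exact isRREF_iff_exists_hasPivots.2 ⟨p, hN⟩
  · rw [hred A τ hτ hA, hred A' τ hτ hA']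
end

section
/- Let 𝔽 be a finite field. For all positive integers k, m, r there exists n ≥ k such that every r-coloring of the set Gr(k, 𝔽ⁿ) of k-dimensional linear subspaces of 𝔽ⁿ admits an m-dimensional subspace W ⊆ 𝔽ⁿ such that all k-dimensional subspaces of W receive the same color. -/
namespace GrahamLeebRothschild

open Module

variable {F : Type} [Field F] {P X Y Z : Type} [AddCommGroup P] [Module F P]
  [AddCommGroup X] [Module F X] [AddCommGroup Y] [Module F Y] [AddCommGroup Z] [Module F Z]

/-- Linear form of the Hales–Jewett theorem: a finite coloring of the linear maps from `P` to a
large space is constant on a translate of a copy of `P →ₗ[F] X`. -/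
theorem exists_mono_linearMap [Finite F] [FiniteDimensional F P] [FiniteDimensional F X]
    (κ : Type) [Finite κ] :
    ∃ (Y : Type) (_ : AddCommGroup Y) (_ : Module F Y) (_ : FiniteDimensional F Y),
      ∀ c : (P →ₗ[F] Y) → κ, ∃ (α : P →ₗ[F] Y) (ι : X →ₗ[F] Y) (a : κ),
        Function.Injective ι ∧ ∀ x : P →ₗ[F] X, c (α + ι ∘ₗ x) = a := by
  have : Finite (P →ₗ[F] F) := Module.finite_of_finite F
  obtain ⟨I, _, hI⟩ := Combinatorics.Subspace.exists_mono_in_high_dimension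
    (P →ₗ[F] F) κ (Fin (finrank F X))
  refine ⟨I → F, inferInstance, inferInstance, inferInstance, fun c ↦ ?_⟩
  obtain ⟨l, a, hl⟩ := hI fun w ↦ c (LinearMap.pi w)
  let b := finBasis F X
  refine ⟨LinearMap.pi fun i ↦ (l.idxFun i).elim id fun _ ↦ 0,
    LinearMap.pi fun i ↦ (l.idxFun i).elim (fun _ ↦ 0) b.coord, a, ?_, fun x ↦ ?_⟩
  · rw [injective_iff_map_eq_zero]
    intro x hx
    refine b.forall_coord_eq_zero_iff.1 fun e ↦ ?_
    obtain ⟨i, hi⟩ := l.proper e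
    simpa [hi] using congrFun hx i
  · rw [← hl fun e ↦ b.coord e ∘ₗ x]
    congr 1
    ext p i
    cases h : l.idxFun i <;> simp [h, Combinatorics.Subspace.apply_def]

/-- `φ` is an injective linear map that covers the identity of the first factor. -/
def IsFiberEmbedding (φ : P × X →ₗ[F] P × Y) : Prop :=
  Function.Injective φ ∧ ∀ v, (φ v).1 = v.1

/-- The fibre over `0` of the projection of `V` to the first factor is the line spanned by `u`. -/
def HasFiber (V : Submodule F (P × X)) (u : X) : Prop :=
  u ≠ 0 ∧ ∀ x, ((0 : P), x) ∈ V ↔ ∃ a : F, a • u = x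

theorem IsFiberEmbedding.comp {φ : P × Y →ₗ[F] P × Z} {ψ : P × X →ₗ[F] P × Y}
    (hφ : IsFiberEmbedding φ) (hψ : IsFiberEmbedding ψ) : IsFiberEmbedding (φ ∘ₗ ψ) :=
  ⟨hφ.1.comp hψ.1, fun v ↦ (hφ.2 _).trans (hψ.2 v)⟩

theorem IsFiberEmbedding.apply_zero {φ : P × X →ₗ[F] P × Y} (hφ : IsFiberEmbedding φ) (x : X) :
    φ (0, x) = (0, (φ (0, x)).2) :=
  Prod.ext (hφ.2 _) rfl

theorem IsFiberEmbedding.map_fst {φ : P × X →ₗ[F] P × Y} (hφ : IsFiberEmbedding φ)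
    (V : Submodule F (P × X)) :
    (V.map φ).map (LinearMap.fst F P Y) = V.map (LinearMap.fst F P X) := by
  rw [← Submodule.map_comp]
  congr 1
  exact LinearMap.ext hφ.2

theorem HasFiber.map {φ : P × X →ₗ[F] P × Y} (hφ : IsFiberEmbedding φ)
    {V : Submodule F (P × X)} {u : X} (hV : HasFiber V u) :
    HasFiber (V.map φ) (φ (0, u)).2 := by
  refine ⟨fun h ↦ hV.1 ?_, fun y ↦ ⟨?_, ?_⟩⟩
  · have : φ (0, u) = φ 0 := by rw [hφ.apply_zero, h, map_zero]; rfl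
    simpa using hφ.1 this
  · rintro ⟨⟨p, x⟩, hv, h⟩
    obtain rfl : p = 0 := by simpa [h] using (hφ.2 (p, x)).symm
    obtain ⟨a, rfl⟩ := (hV.2 x).1 hv
    refine ⟨a, ?_⟩
    rw [← Prod.smul_snd, ← map_smul]
    simp [h]
  · rintro ⟨a, rfl⟩
    refine ⟨a • (0, u), V.smul_mem a ((hV.2 u).2 ⟨1, one_smul _ _⟩), ?_⟩
    rw [map_smul, hφ.apply_zero]
    simp

/-- A subspace that meets the second factor trivially lies on the graph of a linear map. -/
theorem exists_linearMap_of_fiber_eq_zero (W : Submodule F (P × X))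
    (hW : ∀ x, ((0 : P), x) ∈ W → x = 0) :
    ∃ y : P →ₗ[F] X, ∀ v ∈ W, v.2 = y v.1 := by
  obtain ⟨g, hg⟩ := LinearMap.exists_leftInverse_of_injective
    (LinearMap.fst F P X ∘ₗ W.subtype) (by
      rw [LinearMap.ker_eq_bot, injective_iff_map_eq_zero]
      rintro ⟨⟨p, x⟩, hv⟩ (rfl : p = 0)
      simp [hW x hv])
  refine ⟨LinearMap.snd F P X ∘ₗ W.subtype ∘ₗ g, fun v hv ↦ ?_⟩
  have := LinearMap.congr_fun hg ⟨v, hv⟩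
  simp only [LinearMap.comp_apply, LinearMap.id_apply, Submodule.subtype_apply,
    LinearMap.fst_apply] at this
  simp [this]

/-- The map `(p, z) ↦ (p, (y p, z))`. -/
def insertMap (Z : Type) [AddCommGroup Z] [Module F Z] (y : P →ₗ[F] Y) :
    P × Z →ₗ[F] P × (Y × Z) :=
  (LinearMap.fst F P Z).prod ((y ∘ₗ LinearMap.fst F P Z).prod (LinearMap.snd F P Z))

/-- The map `(p, q) ↦ (p, (q, y (p, q)))`. -/
def graphMap (y : P × Y →ₗ[F] Z) : P × Y →ₗ[F] P × (Y × Z) :=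
  (LinearMap.fst F P Y).prod ((LinearMap.snd F P Y).prod y)

@[simp] theorem insertMap_apply (y : P →ₗ[F] Y) (v : P × Z) :
    insertMap Z y v = (v.1, (y v.1, v.2)) := rfl

@[simp] theorem graphMap_apply (y : P × Y →ₗ[F] Z) (v : P × Y) :
    graphMap y v = (v.1, (v.2, y v)) := rfl

theorem isFiberEmbedding_insertMap (y : P →ₗ[F] Y) : IsFiberEmbedding (insertMap Z y) := by
  refine ⟨fun v w h ↦ ?_, fun _ ↦ rfl⟩
  simp only [insertMap_apply, Prod.mk.injEq] at h
  exact Prod.ext h.1 h.2.2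

theorem HasFiber.eq_map_graphMap {V : Submodule F (P × (F × Z))} {a : F} {z : Z}
    (hV : HasFiber V (a, z)) (ha : a ≠ 0) :
    ∃ y : P × F →ₗ[F] Z,
      V = ((V.map (LinearMap.fst F P (F × Z))).prod ⊤).map (graphMap y) := by
  obtain ⟨y, hy⟩ := exists_linearMap_of_fiber_eq_zero
    (V.map (LinearEquiv.prodAssoc F P F Z).symm.toLinearMap) (by
      rintro x ⟨⟨p, s, z'⟩, hv, h⟩
      have hp : p = 0 := congrArg (fun v : (P × F) × Z ↦ v.1.1) h
      have hs : s = 0 := congrArg (fun v : (P × F) × Z ↦ v.1.2) h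
      have hz : z' = x := congrArg Prod.snd h
      subst hp hs hz
      obtain ⟨b, hb⟩ := (hV.2 _).1 hv
      simp only [Prod.smul_mk, Prod.mk.injEq, smul_eq_mul, mul_eq_zero, ha, or_false] at hb
      rw [← hb.2, hb.1, zero_smul])
  have hy' : ∀ p s z', (p, (s, z')) ∈ V → z' = y (p, s) := fun p s z' hv ↦
    hy ((p, s), z') ⟨_, hv, rfl⟩
  refine ⟨y, le_antisymm ?_ ?_⟩
  · rintro ⟨p, s, z'⟩ hv
    refine ⟨(p, s), ⟨⟨_, hv, rfl⟩, trivial⟩, ?_⟩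
    simp [hy' p s z' hv]
  · rintro _ ⟨⟨p, s⟩, ⟨⟨⟨p', s', z'⟩, hv, h⟩, -⟩, rfl⟩
    obtain rfl : p' = p := h
    have hmem := V.add_mem hv (V.smul_mem ((s - s') / a) ((hV.2 _).2 ⟨1, one_smul _ _⟩))
    simp only [Prod.smul_mk, Prod.mk_add_mk, smul_zero, add_zero, smul_eq_mul,
      div_mul_cancel₀ _ ha, add_sub_cancel] at hmem
    rw [graphMap_apply, ← hy' _ _ _ hmem]
    exact hmem

theorem HasFiber.eq_map_insertMap {V : Submodule F (P × (F × Z))} {z : Z}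
    (hV : HasFiber V (0, z)) :
    ∃ (x : P →ₗ[F] F) (U : Submodule F (P × Z)), V = U.map (insertMap Z x) ∧ HasFiber U z ∧
      U.map (LinearMap.fst F P Z) = V.map (LinearMap.fst F P (F × Z)) := by
  obtain ⟨x, hx⟩ := exists_linearMap_of_fiber_eq_zero
    (V.map (LinearMap.id.prodMap (LinearMap.fst F F Z))) (by
      rintro s ⟨⟨p, s', z'⟩, hv, h⟩
      simp only [LinearMap.prodMap_apply, LinearMap.id_apply, LinearMap.fst_apply,
        Prod.mk.injEq] at h
      obtain ⟨rfl, rfl⟩ := h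
      obtain ⟨b, hb⟩ := (hV.2 _).1 hv
      simpa using congrArg Prod.fst hb.symm)
  have hx' : ∀ p s z', (p, (s, z')) ∈ V → s = x p := fun p s z' hv ↦
    hx (p, s) ⟨_, hv, rfl⟩
  have hU : V = (V.comap (insertMap Z x)).map (insertMap Z x) := by
    refine le_antisymm ?_ (Submodule.map_comap_le _ _)
    rintro ⟨p, s, z'⟩ hv
    obtain rfl := hx' p s z' hv
    exact ⟨(p, z'), hv, rfl⟩
  refine ⟨x, V.comap (insertMap Z x), hU, ⟨fun h ↦ hV.1 (by simp [h]), fun z' ↦ ?_⟩, ?_⟩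
  · simp [hV.2]
  · rw [← (isFiberEmbedding_insertMap x).map_fst, ← hU]

theorem isFiberEmbedding_of_subsingleton [Subsingleton X] :
    IsFiberEmbedding ((LinearMap.fst F P X).prod (0 : P × X →ₗ[F] Y)) :=
  ⟨fun _ _ h ↦ Prod.ext (congrArg (fun u ↦ u.1) h) (Subsingleton.elim _ _), fun _ ↦ rfl⟩

/-- Quantitative pigeonhole form of `exists_fiber_mono`, proved by induction on the total number of
dimensions that are requested. -/
theorem exists_fiber_mono_of_sum_eq [Finite F] [FiniteDimensional F P] (κ : Type) [Finite κ]
    [Fintype (Submodule F P → κ)] (n : ℕ) :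
    ∃ (Y : Type) (_ : AddCommGroup Y) (_ : Module F Y) (_ : FiniteDimensional F Y),
      ∀ t : (Submodule F P → κ) → ℕ, ∑ f, t f = n → ∀ c : Submodule F (P × Y) → κ,
        ∃ (X : Type) (_ : AddCommGroup X) (_ : Module F X) (_ : FiniteDimensional F X)
          (φ : P × X →ₗ[F] P × Y) (f : Submodule F P → κ),
          finrank F X = t f ∧ IsFiberEmbedding φ ∧
            ∀ V u, HasFiber V u → c (V.map φ) = f (V.map (LinearMap.fst F P X)) := by
  classical
  have trivial_case : ∀ (Y : Type) [AddCommGroup Y] [Module F Y] (t : (Submodule F P → κ) → ℕ)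
      (c : Submodule F (P × Y) → κ) (f : Submodule F P → κ), t f = 0 →
      ∃ (X : Type) (_ : AddCommGroup X) (_ : Module F X) (_ : FiniteDimensional F X)
          (φ : P × X →ₗ[F] P × Y) (f : Submodule F P → κ),
          finrank F X = t f ∧ IsFiberEmbedding φ ∧
            ∀ V u, HasFiber V u → c (V.map φ) = f (V.map (LinearMap.fst F P X)) :=
    fun Y _ _ t c f hf ↦ ⟨PUnit, inferInstance, inferInstance, inferInstance, _, f,
      by rw [hf, finrank_zero_of_subsingleton], isFiberEmbedding_of_subsingleton,
      fun V u hV ↦ (hV.1 (Subsingleton.elim _ _)).elim⟩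
  induction n with
  | zero =>
    refine ⟨PUnit, inferInstance, inferInstance, inferInstance, fun t ht c ↦ ?_⟩
    exact trivial_case PUnit t c (fun _ ↦ c ⊥) (Finset.sum_eq_zero_iff.1 ht _ (Finset.mem_univ _))
  | succ n ih =>
    obtain ⟨Z, _, _, _, hZ⟩ := ih
    have : Finite (P × Z) := Module.finite_of_finite F
    obtain ⟨Y₁, _, _, _, hY₁⟩ := exists_mono_linearMap (F := F) (P := P) (X := F)
      (Submodule F (P × Z) → κ)
    have : Finite (P × Y₁) := Module.finite_of_finite F
    obtain ⟨Y₂, _, _, _, hY₂⟩ := exists_mono_linearMap (F := F) (P := P × Y₁) (X := Z)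
      (Submodule F (P × Y₁) → κ)
    refine ⟨Y₁ × Y₂, inferInstance, inferInstance, inferInstance, fun t ht c ↦ ?_⟩
    obtain ⟨β, ι₂, k₂, hι₂, hk₂⟩ := hY₂ fun y E ↦ c (E.map (graphMap y))
    -- `(p, (q, z)) ↦ (p, (q, β (p, q) + ι₂ z))`
    let φ₂ : P × (Y₁ × Z) →ₗ[F] P × (Y₁ × Y₂) :=
      LinearMap.prod (LinearMap.fst F _ _) (LinearMap.prod
        (LinearMap.fst F _ _ ∘ₗ LinearMap.snd F _ _)
        (β ∘ₗ LinearMap.id.prodMap (LinearMap.fst F _ _) +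
          ι₂ ∘ₗ LinearMap.snd F _ _ ∘ₗ LinearMap.snd F _ _))
    have hφ₂ : IsFiberEmbedding φ₂ := by
      refine ⟨fun v w h ↦ ?_, fun _ ↦ rfl⟩
      have h1 : v.1 = w.1 := congrArg (fun u ↦ u.1) h
      have h2 : v.2.1 = w.2.1 := congrArg (fun u ↦ u.2.1) h
      have h3 : β (v.1, v.2.1) + ι₂ v.2.2 = β (w.1, w.2.1) + ι₂ w.2.2 :=
        congrArg (fun u ↦ u.2.2) h
      rw [h1, h2, add_right_inj] at h3
      exact Prod.ext h1 (Prod.ext h2 (hι₂ h3))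
    obtain ⟨α, ι₁, k₁, hι₁, hk₁⟩ := hY₁ fun x V ↦ c (V.map (φ₂ ∘ₗ insertMap Z x))
    let j : P × F →ₗ[F] P × Y₁ :=
      (LinearMap.fst F P F).prod (α.coprod ι₁)
    have hj : Function.Injective j := by
      intro v w h
      have h1 : v.1 = w.1 := congrArg (fun u ↦ u.1) h
      have h2 : α v.1 + ι₁ v.2 = α w.1 + ι₁ w.2 := congrArg (fun u ↦ u.2) h
      rw [h1, add_right_inj] at h2
      exact Prod.ext h1 (hι₁ h2)
    obtain ⟨j', hj'⟩ := LinearMap.exists_leftInverse_of_injective j (LinearMap.ker_eq_bot.2 hj)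
    let f₀ : Submodule F P → κ := fun E ↦ k₂ ((E.prod ⊤).map j)
    by_cases h0 : t f₀ = 0
    · exact trivial_case _ t c f₀ h0
    obtain ⟨X, _, _, _, φ, f, hX, hφ, hf⟩ := hZ (Function.update t f₀ (t f₀ - 1)) (by
      have h1 := Finset.add_sum_erase Finset.univ t (Finset.mem_univ f₀)
      have h2 := Finset.add_sum_erase Finset.univ (Function.update t f₀ (t f₀ - 1))
        (Finset.mem_univ f₀)
      rw [Finset.sum_congr rfl fun g hg ↦
        Function.update_of_ne (Finset.ne_of_mem_erase hg) _ _, Function.update_self] at h2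
      omega) k₁
    by_cases hff : f = f₀
    · subst hff
      rw [Function.update_self] at hX
      -- `(p, (s, x)) ↦ (p, (α p + ι₁ s, (φ (p, x)).2))`
      let ψ : P × (F × X) →ₗ[F] P × (Y₁ × Z) :=
        LinearMap.prod (LinearMap.fst F _ _) (LinearMap.prod
          (α.coprod (ι₁ ∘ₗ LinearMap.fst F _ _))
          (LinearMap.snd F _ _ ∘ₗ φ ∘ₗ LinearMap.id.prodMap (LinearMap.snd F _ _)))
      have hψ : IsFiberEmbedding ψ := by
        refine ⟨fun v w h ↦ ?_, fun _ ↦ rfl⟩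
        have h1 : v.1 = w.1 := congrArg (fun u ↦ u.1) h
        have h2 : α v.1 + ι₁ v.2.1 = α w.1 + ι₁ w.2.1 := congrArg (fun u ↦ u.2.1) h
        have h3 : (φ (v.1, v.2.2)).2 = (φ (w.1, w.2.2)).2 := congrArg (fun u ↦ u.2.2) h
        have h4 := hφ.1 (Prod.ext (by rw [hφ.2, hφ.2, h1]) h3)
        rw [h1, add_right_inj] at h2
        exact Prod.ext h1 (Prod.ext (hι₁ h2) (congrArg (fun u ↦ u.2) h4))
      refine ⟨F × X, inferInstance, inferInstance, inferInstance, φ₂ ∘ₗ ψ, f₀, ?_,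
        hφ₂.comp hψ, ?_⟩
      · rw [finrank_prod, finrank_self, hX]
        omega
      rintro V ⟨a, x⟩ hV
      by_cases ha : a = 0
      · subst ha
        obtain ⟨y, U, hU, hUx, hfst⟩ := hV.eq_map_insertMap
        rw [← hfst, ← hf U x hUx, ← congrFun (hk₁ y), hU, ← Submodule.map_comp,
          ← Submodule.map_comp]
        congr 2
        refine LinearMap.ext fun v ↦ ?_
        simp [ψ, φ₂, hφ.2]
      · obtain ⟨y, hy⟩ := hV.eq_map_graphMap ha
        let y' : P × F →ₗ[F] Z :=
          LinearMap.snd F _ _ ∘ₗ φ ∘ₗ (LinearMap.fst F _ _).prod y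
        simp only [f₀]
        rw [← congrFun (hk₂ (y' ∘ₗ j')), ← Submodule.map_comp]
        nth_rw 1 [hy]
        rw [← Submodule.map_comp]
        congr 2
        refine LinearMap.ext fun v ↦ ?_
        have : j' (j v) = v := LinearMap.congr_fun hj' v
        simp only [LinearMap.comp_apply, graphMap_apply, LinearMap.add_apply, this]
        simp [ψ, φ₂, y', j]
    · rw [Function.update_of_ne hff] at hX
      refine ⟨X, inferInstance, inferInstance, inferInstance,
        (φ₂ ∘ₗ insertMap Z α) ∘ₗ φ, f, hX,
        (hφ₂.comp (isFiberEmbedding_insertMap α)).comp hφ, fun V u hV ↦ ?_⟩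
      rw [← hf V u hV, ← congrFun (hk₁ 0), Submodule.map_comp]
      simp

/-- For every coloring of the subspaces of `P × Y`, with `Y` large, there is a copy of `P × X` on
which the color of a subspace with one-dimensional fibre over `P` depends only on its projection
to `P`. -/
theorem exists_fiber_mono [Finite F] [FiniteDimensional F P] [FiniteDimensional F X]
    (κ : Type) [Finite κ] :
    ∃ (Y : Type) (_ : AddCommGroup Y) (_ : Module F Y) (_ : FiniteDimensional F Y),
      ∀ c : Submodule F (P × Y) → κ, ∃ (φ : P × X →ₗ[F] P × Y) (f : Submodule F P → κ),
        IsFiberEmbedding φ ∧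
          ∀ V u, HasFiber V u → c (V.map φ) = f (V.map (LinearMap.fst F P X)) := by
  have : Finite P := Module.finite_of_finite F
  have := Fintype.ofFinite (Submodule F P → κ)
  obtain ⟨Y, _, _, _, hY⟩ := exists_fiber_mono_of_sum_eq (F := F) (P := P) κ
    (∑ _ : Submodule F P → κ, finrank F X)
  refine ⟨Y, inferInstance, inferInstance, inferInstance, fun c ↦ ?_⟩
  obtain ⟨X', _, _, _, φ, f, hX, hφ, hf⟩ := hY _ rfl c
  let e : P × X →ₗ[F] P × X' :=
    LinearMap.id.prodMap (LinearEquiv.ofFinrankEq X X' hX.symm).toLinearMap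
  have he : IsFiberEmbedding e :=
    ⟨Function.injective_id.prodMap (LinearEquiv.injective _), fun _ ↦ rfl⟩
  refine ⟨φ ∘ₗ e, f, hφ.comp he, fun V u hV ↦ ?_⟩
  rw [Submodule.map_comp, hf _ _ (hV.map he), he.map_fst]

/-- A subspace containing a nonzero vector `u` has a hyperplane that avoids `u`. -/
theorem exists_hyperplane_sup_span [FiniteDimensional F X] (V : Submodule F X) {u : X}
    (hu : u ≠ 0) (huV : u ∈ V) :
    ∃ D ≤ V, finrank F D + 1 = finrank F V ∧ u ∉ D ∧ D ⊔ F ∙ u = V := by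
  obtain ⟨K, hK⟩ := Submodule.exists_isCompl (F ∙ u)
  have hle : F ∙ u ≤ V := (Submodule.span_singleton_le_iff_mem u V).2 huV
  have hsup : (K ⊓ V) ⊔ F ∙ u = V := by
    rw [sup_comm, ← sup_inf_assoc_of_le K hle, hK.sup_eq_top, top_inf_eq]
  have hinf : (K ⊓ V) ⊓ F ∙ u = ⊥ :=
    eq_bot_iff.2 ((inf_le_inf_right _ inf_le_left).trans hK.symm.inf_eq_bot.le)
  refine ⟨K ⊓ V, inf_le_right, ?_, fun h ↦ hu ?_, hsup⟩
  · have := Submodule.finrank_sup_add_finrank_inf_eq (K ⊓ V) (F ∙ u)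
    rw [hsup, hinf, finrank_bot, finrank_span_singleton hu] at this
    exact this.symm
  · rw [← Submodule.mem_bot F, ← hinf]
    exact ⟨h, Submodule.mem_span_singleton_self u⟩

theorem map_fst_sup_span_eq (D : Submodule F (P × X)) (u : X) :
    (D ⊔ F ∙ ((0 : P), u)).map (LinearMap.fst F P X) = D.map (LinearMap.fst F P X) := by
  simp [Submodule.map_sup, Submodule.map_span]

/-- For every coloring of the subspaces of `P × Y`, with `Y` large, there are a copy of `P × X`
and a vector `w` such that the color of a subspace `V` that does not embed in `P` is the color of
`D ⊔ span {w}` for a hyperplane `D` of `V`. -/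
theorem exists_color_eq_hyperplane_sup_span [Finite F] (κ : Type) [Finite κ] (t : ℕ) :
    ∀ (P : Type) [AddCommGroup P] [Module F P] [FiniteDimensional F P],
    ∃ (Y : Type) (_ : AddCommGroup Y) (_ : Module F Y) (_ : FiniteDimensional F Y),
      ∀ c : Submodule F (P × Y) → κ,
        ∃ (X : Type) (_ : AddCommGroup X) (_ : Module F X) (_ : FiniteDimensional F X)
          (φ : P × X →ₗ[F] P × Y) (w : Y),
          finrank F X = t ∧ IsFiberEmbedding φ ∧ w ≠ 0 ∧
            ∀ V : Submodule F (P × X), (∃ x ≠ 0, ((0 : P), x) ∈ V) →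
              ∃ D ≤ V, finrank F D + 1 = finrank F V ∧
                c (V.map φ) = c (D.map φ ⊔ F ∙ ((0 : P), w)) := by
  induction t with
  | zero =>
    intro P _ _ _
    refine ⟨F, inferInstance, inferInstance, inferInstance, fun c ↦ ?_⟩
    refine ⟨PUnit, inferInstance, inferInstance, inferInstance, _, 1,
      finrank_zero_of_subsingleton, isFiberEmbedding_of_subsingleton, one_ne_zero, ?_⟩
    rintro V ⟨x, hx, -⟩
    exact (hx (Subsingleton.elim _ _)).elim
  | succ t ih =>
    intro P _ _ _
    obtain ⟨Z, _, _, _, hZ⟩ := ih (P × F)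
    obtain ⟨Y, _, _, _, hY⟩ := exists_fiber_mono (F := F) (P := P) (X := F × Z) κ
    refine ⟨Y, inferInstance, inferInstance, inferInstance, fun c ↦ ?_⟩
    obtain ⟨φ₁, f, hφ₁, hf⟩ := hY c
    let aZ := LinearEquiv.prodAssoc F P F Z
    obtain ⟨X, _, _, _, φ, w, hX, hφ, hw, H⟩ :=
      hZ fun V ↦ c (V.map (φ₁ ∘ₗ aZ.toLinearMap))
    let aX := LinearEquiv.prodAssoc F P F X
    let ψ : P × (F × X) →ₗ[F] P × (F × Z) :=
      aZ.toLinearMap ∘ₗ φ ∘ₗ aX.symm.toLinearMap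
    have hψ : IsFiberEmbedding ψ := by
      refine ⟨aZ.injective.comp (hφ.1.comp aX.symm.injective), fun v ↦ ?_⟩
      exact congrArg Prod.fst (hφ.2 (aX.symm v))
    have hw₀ : (0, w) ≠ (0 : F × Z) := fun h ↦ hw (congrArg (fun u ↦ u.2) h)
    have hw₁ : φ₁ (0, (0, w)) = (0, (φ₁ (0, (0, w))).2) := hφ₁.apply_zero _
    refine ⟨F × X, inferInstance, inferInstance, inferInstance, φ₁ ∘ₗ ψ,
      (φ₁ (0, (0, w))).2, ?_, hφ₁.comp hψ, fun h ↦ ?_, ?_⟩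
    · rw [finrank_prod, finrank_self, hX, add_comm]
    · rw [h] at hw₁
      exact hw₀ (congrArg (fun u ↦ u.2) (hφ₁.1 (hw₁.trans (map_zero φ₁).symm)))
    have key : ∀ D : Submodule F (P × (F × X)),
        D.map (φ₁ ∘ₗ ψ) ⊔ F ∙ ((0 : P), (φ₁ (0, (0, w))).2) =
          (D.map ψ ⊔ F ∙ ((0 : P), ((0 : F), w))).map φ₁ := fun D ↦ by
      rw [Submodule.map_sup, ← Submodule.map_comp, Submodule.map_span, Set.image_singleton, ← hw₁]
    intro V hV
    simp only [key]
    by_cases hV₀ : ∃ x ≠ 0, ((0 : P), ((0 : F), x)) ∈ V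
    · obtain ⟨x, hx, hxV⟩ := hV₀
      obtain ⟨D, hD, hDV, hc⟩ := H (V.map aX.symm.toLinearMap) ⟨x, hx, _, hxV, rfl⟩
      refine ⟨D.map aX.toLinearMap, ?_, ?_, ?_⟩
      · rintro _ ⟨d, hd, rfl⟩
        obtain ⟨v, hv, rfl⟩ := hD hd
        simpa using hv
      · rw [LinearEquiv.finrank_map_eq, hDV, LinearEquiv.finrank_map_eq]
      · have h₁ : ((V.map aX.symm.toLinearMap).map φ).map (φ₁ ∘ₗ aZ.toLinearMap) =
            V.map (φ₁ ∘ₗ ψ) := by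
          simp only [← Submodule.map_comp, ψ, LinearMap.comp_assoc]
        have h₂ : (D.map φ ⊔ F ∙ ((0 : P × F), w)).map (φ₁ ∘ₗ aZ.toLinearMap) =
            ((D.map aX.toLinearMap).map ψ ⊔ F ∙ ((0 : P), ((0 : F), w))).map φ₁ := by
          rw [Submodule.map_comp, Submodule.map_sup, Submodule.map_span, Set.image_singleton,
            ← Submodule.map_comp, ← Submodule.map_comp]
          congr 3
        rw [← h₁, ← h₂, hc]
    · push Not at hV₀
      obtain ⟨⟨a, x⟩, hax, hV⟩ := hV
      have ha : a ≠ 0 := by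
        rintro rfl
        exact hV₀ x (fun h ↦ hax (by rw [h]; rfl)) hV
      have hVu : HasFiber V (a, x) := by
        refine ⟨hax, fun ⟨b, z⟩ ↦ ⟨fun h ↦ ⟨b / a, ?_⟩, ?_⟩⟩
        · have hmem := V.sub_mem h (V.smul_mem (b / a) hV)
          simp only [Prod.smul_mk, smul_zero, smul_eq_mul, div_mul_cancel₀ _ ha,
            Prod.mk_sub_mk, sub_self] at hmem
          have hz : z - (b / a) • x = 0 := by
            by_contra hne
            exact hV₀ _ hne hmem
          rw [Prod.smul_mk, smul_eq_mul, div_mul_cancel₀ _ ha, sub_eq_zero.1 hz]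
        · rintro ⟨s, hs⟩
          have hmem := V.smul_mem s hV
          rwa [Prod.smul_mk, smul_zero, hs] at hmem
      obtain ⟨D, hD, hDV, huD, hsup⟩ := exists_hyperplane_sup_span V
        (u := ((0 : P), (a, x))) (fun h ↦ hax (congrArg (fun u ↦ u.2) h)) hV
      refine ⟨D, hD, hDV, ?_⟩
      have hD₀ : ∀ y, ((0 : P), y) ∈ D → y = 0 := by
        intro y hy
        obtain ⟨s, rfl⟩ := (hVu.2 y).1 (hD hy)
        by_contra hs
        have hs' : s ≠ 0 := fun h ↦ hs (by rw [h, zero_smul])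
        refine huD ?_
        have hmem := D.smul_mem s⁻¹ hy
        rwa [Prod.smul_mk, smul_zero, inv_smul_smul₀ hs'] at hmem
      have hU : HasFiber (D.map ψ ⊔ F ∙ ((0 : P), ((0 : F), w))) (0, w) := by
        refine ⟨hw₀, fun y ↦ ⟨fun h ↦ ?_, ?_⟩⟩
        · obtain ⟨_, ⟨⟨p, z⟩, hd, rfl⟩, _, hl, hsum⟩ := Submodule.mem_sup.1 h
          obtain ⟨s, rfl⟩ := Submodule.mem_span_singleton.1 hl
          obtain rfl : p = 0 := by
            have h₁ := congrArg (fun u ↦ u.1) hsum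
            simpa [hψ.2] using h₁
          obtain rfl := hD₀ z hd
          refine ⟨s, ?_⟩
          have h₂ := congrArg (fun u ↦ u.2) hsum
          rw [Prod.mk_zero_zero, map_zero, zero_add] at h₂
          exact h₂
        · rintro ⟨s, rfl⟩
          refine Submodule.mem_sup_right (Submodule.mem_span_singleton.2 ⟨s, ?_⟩)
          rw [Prod.smul_mk, smul_zero]
      rw [Submodule.map_comp, hf _ _ (hVu.map hψ), hf _ _ hU, hψ.map_fst, map_fst_sup_span_eq,
        hψ.map_fst, ← map_fst_sup_span_eq D (a, x), hsup]

/-- A space of dimension `n` has subspaces of every dimension `m ≤ n`. -/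
theorem exists_submodule_finrank_eq [FiniteDimensional F X] {m : ℕ} (hm : m ≤ finrank F X) :
    ∃ W : Submodule F X, finrank F W = m := by
  obtain ⟨v, hv⟩ := exists_linearIndependent_of_le_finrank hm
  exact ⟨Submodule.span F (Set.range v), by rw [finrank_span_eq_card hv, Fintype.card_fin]⟩

/-- Vector space Ramsey theorem, for an arbitrary space of sufficiently large dimension `n`. -/
theorem exists_mono_submodule (F : Type) [Field F] [Finite F] (κ : Type) [Finite κ] (k m : ℕ) :
    ∃ n : ℕ, ∀ (X : Type) [AddCommGroup X] [Module F X] [FiniteDimensional F X],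
      finrank F X = n → ∀ c : Submodule F X → κ,
        ∃ W : Submodule F X, finrank F W = m ∧ ∃ a : κ,
          ∀ V ≤ W, finrank F V = k → c V = a := by
  induction k with
  | zero =>
    refine ⟨m, fun X _ _ _ hX c ↦ ⟨⊤, by rw [finrank_top, hX], c ⊥, fun V _ hV ↦ ?_⟩⟩
    rw [Submodule.finrank_eq_zero.1 hV]
  | succ k ih =>
    obtain ⟨t, ht⟩ := ih
    obtain ⟨Y, _, _, _, hY⟩ := exists_color_eq_hyperplane_sup_span (F := F) κ t PUnit
    refine ⟨finrank F (PUnit × Y), fun Z _ _ _ hZ c ↦ ?_⟩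
    let e := LinearEquiv.ofFinrankEq (PUnit × Y) Z hZ.symm
    obtain ⟨X, _, _, _, φ, w, hX, hφ, -, H⟩ := hY fun V ↦ c (V.map e.toLinearMap)
    obtain ⟨W, hW, a, ha⟩ := ht (PUnit × X)
      (by rw [finrank_prod, finrank_zero_of_subsingleton, hX, zero_add])
      fun D ↦ c ((D.map φ ⊔ F ∙ ((0 : PUnit), w)).map e.toLinearMap)
    have hinj : Function.Injective (e.toLinearMap ∘ₗ φ) := e.injective.comp hφ.1
    have hrank : ∀ U : Submodule F (PUnit × X),
        finrank F (U.map (e.toLinearMap ∘ₗ φ)) = finrank F U := fun U ↦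
      (Submodule.equivMapOfInjective _ hinj U).finrank_eq.symm
    refine ⟨W.map (e.toLinearMap ∘ₗ φ), by rw [hrank, hW], a, fun V hVW hV ↦ ?_⟩
    obtain ⟨U, hUW, rfl⟩ : ∃ U ≤ W, U.map (e.toLinearMap ∘ₗ φ) = V := by
      refine ⟨V.comap (e.toLinearMap ∘ₗ φ), ?_, ?_⟩
      · rw [← Submodule.comap_map_eq_of_injective hinj W]
        exact Submodule.comap_mono hVW
      · exact Submodule.map_comap_eq_self (hVW.trans LinearMap.map_le_range)
    rw [hrank] at hV
    have hU : U ≠ ⊥ := fun h ↦ by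
      rw [h, finrank_bot] at hV
      exact Nat.succ_ne_zero k hV.symm
    obtain ⟨⟨p, x⟩, hu, hu₀⟩ := Submodule.exists_mem_ne_zero_of_ne_bot hU
    obtain ⟨D, hDU, hD, hc⟩ := H U
      ⟨x, fun h ↦ hu₀ (Prod.ext (Subsingleton.elim _ _) h), hu⟩
    rw [Submodule.map_comp, hc]
    exact ha D (hDU.trans hUW) (by omega)

end GrahamLeebRothschild

/-- The Graham–Leeb–Rothschild theorem: for a finite field `𝔽` and positive integers
`k, m, r` there is `n ≥ k` such that every `r`-coloring of the `k`-dimensional subspaces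
of `𝔽ⁿ` admits an `m`-dimensional subspace `W` all of whose `k`-dimensional subspaces
receive the same color. -/
theorem graham_leeb_rothschild
    (𝔽 : Type) [Field 𝔽] [Fintype 𝔽] (k m r : ℕ) (hk : 0 < k) (hm : 0 < m) (hr : 0 < r) :
    ∃ n : ℕ, k ≤ n ∧
      ∀ c : Submodule 𝔽 (Fin n → 𝔽) → Fin r,
        ∃ W : Submodule 𝔽 (Fin n → 𝔽), Module.finrank 𝔽 W = m ∧
          ∀ V V' : Submodule 𝔽 (Fin n → 𝔽),
            Module.finrank 𝔽 V = k → Module.finrank 𝔽 V' = k →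
            V ≤ W → V' ≤ W → c V = c V' := by
  obtain ⟨n, hn⟩ := GrahamLeebRothschild.exists_mono_submodule 𝔽 (Fin r) k (max k m)
  have hn' := hn (Fin n → 𝔽) (Module.finrank_fin_fun 𝔽)
  refine ⟨n, ?_, fun c ↦ ?_⟩
  · obtain ⟨W, hW, -⟩ := hn' fun _ ↦ ⟨0, hr⟩
    have := Submodule.finrank_le W
    rw [hW, Module.finrank_fin_fun] at this
    exact (le_max_left k m).trans this
  · obtain ⟨W, hW, a, ha⟩ := hn' c
    obtain ⟨U, hU⟩ := GrahamLeebRothschild.exists_submodule_finrank_eq (F := 𝔽) (X := W)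
      (m := m) (hW ▸ le_max_right k m)
    have hUW : U.map W.subtype ≤ W := Submodule.map_subtype_le W U
    refine ⟨U.map W.subtype, by rw [Submodule.finrank_map_subtype_eq, hU],
      fun V V' hV hV' hVU hVU' ↦ ?_⟩
    rw [ha V (hVU.trans hUW) hV, ha V' (hVU'.trans hUW) hV']
end

section
/- Let q, s, q₁, s₁, …, qₙ, sₙ be positive integers, let φᵢ : M_{q,s} → M_{qᵢ,sᵢ} be completely contractive linear maps for i = 1,…,n, and let φ : M_{q,s} → M_{q₁,s₁} ⊕_∞ ⋯ ⊕_∞ M_{qₙ,sₙ} be the map x ↦ (φ₁(x),…,φₙ(x)). Then φ is completely isometric if and only if some φᵢ is completely isometric. -/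
/-- The operator norm of a complex matrix, viewed as an operator between Euclidean spaces. -/
noncomputable def matOpNorm {m n : Type} [Fintype m] [Fintype n] [DecidableEq n]
    (A : Matrix m n ℂ) : ℝ :=
  ‖LinearMap.toContinuousLinearMap (Matrix.toEuclideanLin A)‖

/-- The `n`-th amplification of a linear map between matrix operator spaces
`M_{q,s} → M_{q',s'}`, applied blockwise to an element of `M_n(M_{q,s})`. -/
def ampl {q s q' s' : ℕ} (n : ℕ)
    (φ : Matrix (Fin q) (Fin s) ℂ → Matrix (Fin q') (Fin s') ℂ)
    (M : Matrix (Fin n × Fin q) (Fin n × Fin s) ℂ) :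
    Matrix (Fin n × Fin q') (Fin n × Fin s') ℂ :=
  fun x y => φ (fun a b => M (x.1, a) (y.1, b)) x.2 y.2

/-- A map between matrix operator spaces is completely contractive if all its
amplifications are contractive. -/
def CompletelyContractive {q s q' s' : ℕ}
    (φ : Matrix (Fin q) (Fin s) ℂ → Matrix (Fin q') (Fin s') ℂ) : Prop :=
  ∀ (n : ℕ) (M : Matrix (Fin n × Fin q) (Fin n × Fin s) ℂ),
    matOpNorm (ampl n φ M) ≤ matOpNorm M

/-- A map between matrix operator spaces is completely isometric if all its
amplifications are isometric. -/
def CompletelyIsometric {q s q' s' : ℕ}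
    (φ : Matrix (Fin q) (Fin s) ℂ → Matrix (Fin q') (Fin s') ℂ) : Prop :=
  ∀ (n : ℕ) (M : Matrix (Fin n × Fin q) (Fin n × Fin s) ℂ),
    matOpNorm (ampl n φ M) = matOpNorm M

open Matrix in
theorem toEuclideanLin_apply_coord {m n : Type} [Fintype m] [Fintype n] [DecidableEq n]
    (A : Matrix m n ℂ) (v : EuclideanSpace ℂ n) (i : m) :
    toEuclideanLin A v i = ∑ j, A i j * v j :=
  rfl

open Matrix in
theorem norm_toEuclideanLin_le_matOpNorm {m n : Type} [Fintype m] [Fintype n] [DecidableEq n]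
    (A : Matrix m n ℂ) (v : EuclideanSpace ℂ n) :
    ‖toEuclideanLin A v‖ ≤ matOpNorm A * ‖v‖ :=
  (LinearMap.toContinuousLinearMap (toEuclideanLin A)).le_opNorm v

open Matrix in
theorem matOpNorm_le_of_forall {m n : Type} [Fintype m] [Fintype n] [DecidableEq n]
    {A : Matrix m n ℂ} {C : ℝ} (hC : 0 ≤ C)
    (h : ∀ v, ‖toEuclideanLin A v‖ ≤ C * ‖v‖) : matOpNorm A ≤ C :=
  ContinuousLinearMap.opNorm_le_bound _ hC h

theorem matOpNorm_nonneg {m n : Type} [Fintype m] [Fintype n] [DecidableEq n]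
    (A : Matrix m n ℂ) : 0 ≤ matOpNorm A :=
  norm_nonneg _

open Matrix in
theorem exists_norm_toEuclideanLin_eq_matOpNorm {m n : Type} [Fintype m] [Fintype n]
    [DecidableEq n] [Nonempty n] (A : Matrix m n ℂ) :
    ∃ v : EuclideanSpace ℂ n, ‖v‖ = 1 ∧ ‖toEuclideanLin A v‖ = matOpNorm A := by
  let T := LinearMap.toContinuousLinearMap (toEuclideanLin A)
  obtain ⟨v, hv, hmax⟩ := (isCompact_sphere (0 : EuclideanSpace ℂ n) 1).exists_isMaxOn
    (NormedSpace.sphere_nonempty.2 zero_le_one) (f := fun v => ‖T v‖) (by fun_prop)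
  have hv1 : ‖v‖ = 1 := by simpa using hv
  refine ⟨v, hv1, le_antisymm ?_ ?_⟩
  · simpa [hv1] using norm_toEuclideanLin_le_matOpNorm A v
  · refine matOpNorm_le_of_forall (norm_nonneg _) fun w => ?_
    rcases eq_or_ne w 0 with rfl | hw
    · simp
    have hw0 : ‖w‖ ≠ 0 := norm_ne_zero_iff.2 hw
    have := hmax (a := ((‖w‖⁻¹ : ℝ) : ℂ) • w) (by simp [norm_smul, hw0])
    have h2 : ‖w‖⁻¹ * ‖T w‖ ≤ ‖T v‖ := by simpa [norm_smul] using this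
    have h3 : ‖T w‖ ≤ ‖T v‖ * ‖w‖ := by
      rw [inv_mul_le_iff₀ (by positivity)] at h2
      linarith
    exact h3

open Matrix in
theorem matOpNorm_mul_le {l m n : Type} [Fintype l] [Fintype m] [Fintype n] [DecidableEq m]
    [DecidableEq n] (A : Matrix l m ℂ) (B : Matrix m n ℂ) :
    matOpNorm (A * B) ≤ matOpNorm A * matOpNorm B :=
  letI := Classical.decEq l
  Matrix.l2_opNorm_mul A B

open Matrix in
theorem matOpNorm_conjTranspose {m n : Type} [Fintype m] [Fintype n] [DecidableEq m]
    [DecidableEq n] (A : Matrix m n ℂ) : matOpNorm Aᴴ = matOpNorm A :=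
  Matrix.l2_opNorm_conjTranspose A

open Matrix in
theorem matOpNorm_le_one_of_conjTranspose_mul_self {m n : Type} [Fintype m] [Fintype n]
    [DecidableEq m] [DecidableEq n] {A : Matrix m n ℂ} (h : Aᴴ * A = 1) : matOpNorm A ≤ 1 := by
  have h1 : matOpNorm (Aᴴ * A) = matOpNorm A * matOpNorm A :=
    Matrix.l2_opNorm_conjTranspose_mul_self A
  have h2 : matOpNorm (1 : Matrix n n ℂ) ≤ 1 :=
    matOpNorm_le_of_forall zero_le_one fun v => by simp
  rw [h] at h1
  nlinarith [matOpNorm_nonneg A]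

open Matrix in
/-- The operator norm is dominated by the Hilbert–Schmidt norm. -/
theorem matOpNorm_sq_le_sum {m n : Type} [Fintype m] [Fintype n] [DecidableEq n]
    (A : Matrix m n ℂ) : matOpNorm A ^ 2 ≤ ∑ i, ∑ j, ‖A i j‖ ^ 2 := by
  have h0 : 0 ≤ ∑ i, ∑ j, ‖A i j‖ ^ 2 := by positivity
  refine (Real.le_sqrt (matOpNorm_nonneg A) h0).1 ?_
  refine matOpNorm_le_of_forall (Real.sqrt_nonneg _) fun v => ?_
  rw [← sq_le_sq₀ (norm_nonneg _) (by positivity), mul_pow, Real.sq_sqrt h0,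
    EuclideanSpace.norm_sq_eq, EuclideanSpace.norm_sq_eq, Finset.sum_mul]
  refine Finset.sum_le_sum fun i _ => ?_
  rw [toEuclideanLin_apply_coord]
  calc ‖∑ j, A i j * v j‖ ^ 2 ≤ (∑ j, ‖A i j‖ * ‖v j‖) ^ 2 := by
        gcongr
        exact (norm_sum_le _ _).trans_eq (by simp)
    _ ≤ _ := Finset.sum_mul_sq_le_sq_mul_sq _ _ _

open Matrix in
theorem matOpNorm_single_add_single_sq_le {m n : Type} [Fintype m] [Fintype n] [DecidableEq m]
    [DecidableEq n] {i k : m} {j l : n} (h : (i, j) ≠ (k, l)) (t : ℂ) :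
    matOpNorm (single k l (1 : ℂ) + t • single i j (1 : ℂ)) ^ 2 ≤ 1 + ‖t‖ ^ 2 := by
  refine (matOpNorm_sq_le_sum _).trans_eq ?_
  have key : ∀ p : m × n, ‖(single k l (1 : ℂ) + t • single i j (1 : ℂ)) p.1 p.2‖ ^ 2
      = (if (k, l) = p then 1 else 0) + (if (i, j) = p then ‖t‖ ^ 2 else 0) := by
    rintro ⟨a, b⟩
    simp only [Matrix.add_apply, Matrix.smul_apply, single_apply, Prod.mk.injEq]
    by_cases h1 : k = a ∧ l = b <;> by_cases h2 : i = a ∧ j = b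
    · exact absurd (by rw [h1.1, h1.2, h2.1, h2.2]) h
    all_goals simp [h1, h2]
  rw [← Fintype.sum_prod_type' fun a b =>
    ‖(single k l (1 : ℂ) + t • single i j (1 : ℂ)) a b‖ ^ 2, Finset.sum_congr rfl fun p _ => key p]
  simp [Finset.sum_add_distrib]

open Matrix in
theorem matOpNorm_single_le_one {m n : Type} [Fintype m] [Fintype n] [DecidableEq m]
    [DecidableEq n] (k : m) (l : n) : matOpNorm (single k l (1 : ℂ)) ≤ 1 := by
  have h := matOpNorm_sq_le_sum (single k l (1 : ℂ))
  have h2 : ∑ i, ∑ j, ‖single k l (1 : ℂ) i j‖ ^ 2 = 1 := by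
    rw [← Fintype.sum_prod_type' fun a b => ‖single k l (1 : ℂ) a b‖ ^ 2,
      Finset.sum_eq_single (k, l)]
    · simp
    · rintro ⟨a, b⟩ - hne
      have : ¬ (k = a ∧ l = b) := fun h => hne (by rw [h.1, h.2])
      simp [this]
    · simp
  rw [h2] at h
  nlinarith [matOpNorm_nonneg (single k l (1 : ℂ))]

open Matrix in
/-- A matrix unit exposes the corresponding coordinate functional: a functional bounded by `C`
and equal to `C` at a matrix unit vanishes at all others. -/
theorem functional_single_eq_zero {m n : Type} [Fintype m] [Fintype n] [DecidableEq m]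
    [DecidableEq n] (f : Matrix m n ℂ →ₗ[ℂ] ℂ) {C : ℝ} (hC : 0 < C)
    (hf : ∀ x, ‖f x‖ ≤ C * matOpNorm x) {k i : m} {l j : n}
    (hkl : f (single k l 1) = C) (h : (i, j) ≠ (k, l)) : f (single i j 1) = 0 := by
  set c := f (single i j 1) with hc
  have hC0 : (C : ℂ) ≠ 0 := by exact_mod_cast hC.ne'
  have h1 := hf (single k l 1 + (star c / C) • single i j 1)
  have h2 := matOpNorm_single_add_single_sq_le h (star c / C)
  set N := matOpNorm (single k l (1 : ℂ) + (star c / C) • single i j (1 : ℂ)) with hN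
  have h3 : ((C : ℂ) + star c / C * c) = ((C * (1 + (‖c‖ / C) ^ 2) : ℝ) : ℂ) := by
    have : star c * c = (‖c‖ : ℂ) ^ 2 := Complex.conj_mul' c
    push_cast
    rw [div_mul_eq_mul_div, this]
    field_simp
  rw [map_add, map_smul, hkl, ← hc, smul_eq_mul, h3, Complex.norm_of_nonneg (by positivity)] at h1
  have h4 := le_of_mul_le_mul_left h1 hC
  rw [norm_div, norm_star, Complex.norm_of_nonneg hC.le] at h2
  have h5 : (‖c‖ / C) ^ 2 = 0 := by nlinarith [sq_nonneg (‖c‖ / C)]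
  simpa [hC.ne'] using h5

open Matrix in
theorem CompletelyContractive.matOpNorm_apply_le {q s q' s' : ℕ}
    {φ : Matrix (Fin q) (Fin s) ℂ → Matrix (Fin q') (Fin s') ℂ} (hφ : CompletelyContractive φ)
    (x : Matrix (Fin q) (Fin s) ℂ) : matOpNorm (φ x) ≤ matOpNorm x := by
  have aux : ∀ {k l : ℕ} (y : Matrix (Fin k) (Fin l) ℂ),
      matOpNorm (y.submatrix (Prod.snd : Fin 1 × Fin k → _) (Prod.snd : Fin 1 × Fin l → _)) = matOpNorm y := by
    intro k l y
    apply le_antisymm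
    · refine matOpNorm_le_of_forall (matOpNorm_nonneg _) fun v => ?_
      have := norm_toEuclideanLin_le_matOpNorm y (WithLp.toLp 2 fun b => v (0, b))
      rw [← sq_le_sq₀ (norm_nonneg _) (by have := matOpNorm_nonneg y; positivity)] at this ⊢
      rw [mul_pow, EuclideanSpace.norm_sq_eq, EuclideanSpace.norm_sq_eq] at this ⊢
      simpa [toEuclideanLin_apply_coord, Fintype.sum_prod_type, mulVec, dotProduct] using this
    · refine matOpNorm_le_of_forall (matOpNorm_nonneg _) fun v => ?_
      have := norm_toEuclideanLin_le_matOpNorm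
        (y.submatrix (Prod.snd : Fin 1 × Fin k → _) (Prod.snd : Fin 1 × Fin l → _)) (WithLp.toLp 2 fun b => v b.2)
      have h0 := matOpNorm_nonneg (y.submatrix (Prod.snd : Fin 1 × Fin k → _) (Prod.snd : Fin 1 × Fin l → _))
      rw [← sq_le_sq₀ (norm_nonneg _) (by positivity)] at this ⊢
      rw [mul_pow, EuclideanSpace.norm_sq_eq, EuclideanSpace.norm_sq_eq] at this ⊢
      simpa [toEuclideanLin_apply_coord, Fintype.sum_prod_type, mulVec, dotProduct] using this
  have h := hφ 1 (x.submatrix Prod.snd Prod.snd)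
  rw [aux x] at h
  rw [← aux (φ x)]
  exact h

open Matrix in
open scoped Kronecker in
/-- A completely contractive map with a left inverse of the form `y ↦ Vᴴ y W`, where `V` and `W`
are isometries, is completely isometric. -/
theorem completelyIsometric_of_compression {q s q' s' : ℕ}
    {φ : Matrix (Fin q) (Fin s) ℂ → Matrix (Fin q') (Fin s') ℂ} (hφ : CompletelyContractive φ)
    {V : Matrix (Fin q') (Fin q) ℂ} {W : Matrix (Fin s') (Fin s) ℂ} (hV : Vᴴ * V = 1)
    (hW : Wᴴ * W = 1) (h : ∀ x, Vᴴ * φ x * W = x) : CompletelyIsometric φ := by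
  intro n M
  refine le_antisymm (hφ n M) ?_
  have key : ((1 : Matrix (Fin n) (Fin n) ℂ) ⊗ₖ V)ᴴ * ampl n φ M *
      ((1 : Matrix (Fin n) (Fin n) ℂ) ⊗ₖ W) = M := by
    ext ⟨k, a⟩ ⟨l, b⟩
    have := congrFun (congrFun (h fun a b => M (k, a) (l, b)) a) b
    refine Eq.trans ?_ this
    simp [Matrix.mul_apply, Fintype.sum_prod_type, ampl, Matrix.one_apply,
      Finset.sum_mul, ite_mul, mul_ite, apply_ite (star : ℂ → ℂ)]
  have hV1 : matOpNorm ((1 : Matrix (Fin n) (Fin n) ℂ) ⊗ₖ V) ≤ 1 :=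
    matOpNorm_le_one_of_conjTranspose_mul_self (by
      rw [conjTranspose_kronecker, ← mul_kronecker_mul, hV]; simp)
  have hW1 : matOpNorm ((1 : Matrix (Fin n) (Fin n) ℂ) ⊗ₖ W) ≤ 1 :=
    matOpNorm_le_one_of_conjTranspose_mul_self (by
      rw [conjTranspose_kronecker, ← mul_kronecker_mul, hW]; simp)
  rw [← matOpNorm_conjTranspose] at hV1
  calc matOpNorm M = _ := by rw [key]
    _ ≤ _ := matOpNorm_mul_le _ _
    _ ≤ (1 * matOpNorm (ampl n φ M)) * 1 := by
      refine mul_le_mul ((matOpNorm_mul_le _ _).trans ?_) hW1 (matOpNorm_nonneg _) ?_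
      · exact mul_le_mul_of_nonneg_right hV1 (matOpNorm_nonneg _)
      · simpa using matOpNorm_nonneg (ampl n φ M)
    _ = _ := by ring

open Matrix in
/-- The vectors `b j` and `a i` of equal norm with `φ (E i j) (b j) = a i` span copies of the
domain and codomain of `M_{q,s}` inside which `φ` restricts to the identity. -/
theorem completelyIsometric_of_vectors {q s q' s' : ℕ} (hq : 0 < q) (hs : 0 < s)
    (φ : Matrix (Fin q) (Fin s) ℂ →ₗ[ℂ] Matrix (Fin q') (Fin s') ℂ)
    (hφ : CompletelyContractive φ)
    (a : Fin q → EuclideanSpace ℂ (Fin q')) (b : Fin s → EuclideanSpace ℂ (Fin s'))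
    (ha : ∀ i, ‖a i‖ = 1) (hb : ∀ j, ‖b j‖ = 1)
    (hab : ∀ i j, toEuclideanLin (φ (single i j 1)) (b j) = a i) : CompletelyIsometric φ := by
  have hbound : ∀ x v, ‖toEuclideanLin (φ x) v‖ ≤ matOpNorm x * ‖v‖ := fun x v =>
    (norm_toEuclideanLin_le_matOpNorm _ _).trans (by gcongr; exact hφ.matOpNorm_apply_le x)
  -- the compression of `φ` is the identity
  have hcoef : ∀ k l i j, inner ℂ (a k) (toEuclideanLin (φ (single i j 1)) (b l))
      = if i = k ∧ j = l then 1 else 0 := by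
    intro k l i j
    split_ifs with h
    · rw [h.1, h.2, hab, inner_self_eq_norm_sq_to_K, ha]
      simp
    · let f : Matrix (Fin q) (Fin s) ℂ →ₗ[ℂ] ℂ :=
        (innerSL ℂ (a k)).toLinearMap ∘ₗ (LinearMap.applyₗ (b l)) ∘ₗ toEuclideanLin.toLinearMap ∘ₗ φ
      refine functional_single_eq_zero f (C := 1) one_pos (fun x => ?_) (k := k) (l := l) ?_ ?_
      · refine (norm_inner_le_norm (𝕜 := ℂ) (a k) (toEuclideanLin (φ x) (b l))).trans ?_
        rw [ha]
        simpa [hb] using hbound x (b l)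
      · change inner ℂ (a k) (toEuclideanLin (φ (single k l 1)) (b l)) = _
        rw [hab, inner_self_eq_norm_sq_to_K, ha]
        simp
      · simpa using h
  have ha' : ∀ k i, inner ℂ (a k) (a i) = if i = k then (1 : ℂ) else 0 := by
    intro k i
    have := hcoef k ⟨0, hs⟩ i ⟨0, hs⟩
    simpa [hab] using this
  have hb' : ∀ j l, inner ℂ (b j) (b l) = if j = l then (1 : ℂ) else 0 := by
    intro j l
    let i : Fin q := ⟨0, hq⟩
    let T := LinearMap.toContinuousLinearMap (toEuclideanLin (φ (single i j 1)))
    have hT : ‖T‖ ≤ 1 := (hφ.matOpNorm_apply_le _).trans (matOpNorm_single_le_one i j)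
    have hTb : T (b j) = a i := hab i j
    have hadj : ContinuousLinearMap.adjoint T (a i) = b j := by
      have h1 : ‖ContinuousLinearMap.adjoint T (a i)‖ ≤ 1 := by
        refine (ContinuousLinearMap.le_opNorm _ _).trans ?_
        rw [ha, mul_one, LinearIsometryEquiv.norm_map]
        exact hT
      have h2 := norm_sub_sq (𝕜 := ℂ) (ContinuousLinearMap.adjoint T (a i)) (b j)
      rw [ContinuousLinearMap.adjoint_inner_left, hTb, inner_self_eq_norm_sq_to_K, ha, hb] at h2
      norm_num at h2
      have h3 : ‖ContinuousLinearMap.adjoint T (a i) - b j‖ ^ 2 = 0 := by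
        nlinarith [sq_nonneg ‖ContinuousLinearMap.adjoint T (a i) - b j‖,
          norm_nonneg (ContinuousLinearMap.adjoint T (a i))]
      simpa [sub_eq_zero] using h3
    rw [← hadj, ContinuousLinearMap.adjoint_inner_left]
    change inner ℂ (a i) (toEuclideanLin (φ (single i j 1)) (b l)) = _
    simpa using hcoef i l i j
  refine completelyIsometric_of_compression hφ (V := of fun p i => a i p)
    (W := of fun t j => b j t) ?_ ?_ fun x => ?_
  · ext k i
    have := ha' k i
    rw [PiLp.inner_apply] at this
    simpa [Matrix.mul_apply, mul_comm, Matrix.one_apply, eq_comm] using this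
  · ext k i
    have := hb' k i
    rw [PiLp.inner_apply] at this
    simpa [Matrix.mul_apply, mul_comm, Matrix.one_apply] using this
  · ext k l
    have hform : ∀ y : Matrix (Fin q') (Fin s') ℂ,
        ((of fun p i => a i p)ᴴ * y * (of fun t j => b j t)) k l
          = inner ℂ (a k) (toEuclideanLin y (b l)) := by
      intro y
      rw [Matrix.mul_assoc, Matrix.mul_apply, PiLp.inner_apply]
      simp [toEuclideanLin_apply_coord, Matrix.mul_apply, mul_comm]
    rw [hform]
    conv_lhs => rw [matrix_eq_sum_single x]
    have hsingle : ∀ i j, single i j (x i j) = x i j • single i j (1 : ℂ) := by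
      intro i j; simp
    simp only [hsingle, map_sum, map_smul, LinearMap.sum_apply, LinearMap.smul_apply, inner_sum,
      inner_smul_right, hcoef]
    simp [ite_and]

/-- The Choi block matrix `∑ i j, E i j ⊗ E i j`, padded to square outer format. -/
def choiMatrix (q s : ℕ) : Matrix (Fin (q + s) × Fin q) (Fin (q + s) × Fin s) ℂ :=
  fun x y => if x.1 = Fin.castAdd s x.2 ∧ y.1 = Fin.natAdd q y.2 then 1 else 0

open Matrix in
theorem norm_sq_ampl_choiMatrix_apply {q s q' s' : ℕ}
    (φ : Matrix (Fin q) (Fin s) ℂ →ₗ[ℂ] Matrix (Fin q') (Fin s') ℂ)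
    (β : EuclideanSpace ℂ (Fin (q + s) × Fin s')) :
    ‖toEuclideanLin (ampl (q + s) φ (choiMatrix q s)) β‖ ^ 2 =
      ∑ i, ‖∑ j, toEuclideanLin (φ (single i j 1))
        (WithLp.toLp 2 fun t => β (Fin.natAdd q j, t))‖ ^ 2 := by
  have hblock : ∀ k l, of (fun a b => choiMatrix q s (k, a) (l, b)) =
      ∑ i, ∑ j, (if k = Fin.castAdd s i ∧ l = Fin.natAdd q j then (1 : ℂ) else 0) •
        single i j (1 : ℂ) := by
    intro k l
    rw [matrix_eq_sum_single (of fun a b => choiMatrix q s (k, a) (l, b))]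
    refine Finset.sum_congr rfl fun i _ => Finset.sum_congr rfl fun j _ => ?_
    by_cases h : k = Fin.castAdd s i ∧ l = Fin.natAdd q j <;> simp [choiMatrix, h]
  have hentry : ∀ k p l t, ampl (q + s) φ (choiMatrix q s) (k, p) (l, t) =
      ∑ i, ∑ j, (if k = Fin.castAdd s i ∧ l = Fin.natAdd q j then (1 : ℂ) else 0) *
        φ (single i j 1) p t := by
    intro k p l t
    change φ (of fun a b => choiMatrix q s (k, a) (l, b)) p t = _
    rw [hblock]
    simp only [map_sum, map_smul, Matrix.sum_apply, Matrix.smul_apply, smul_eq_mul]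
  have hne : ∀ (i : Fin q) (j : Fin s), Fin.castAdd s i ≠ Fin.natAdd q j := by
    intro i j h
    have := congrArg Fin.val h
    simp at this
    omega
  rw [EuclideanSpace.norm_sq_eq, Fintype.sum_prod_type, Fin.sum_univ_add]
  have h1 : ∀ (i : Fin q) (p : Fin q'),
      toEuclideanLin (ampl (q + s) φ (choiMatrix q s)) β (Fin.castAdd s i, p) =
        (∑ j, toEuclideanLin (φ (single i j 1))
          (WithLp.toLp 2 fun t => β (Fin.natAdd q j, t))) p := by
    intro i p
    rw [toEuclideanLin_apply_coord, Fintype.sum_prod_type, Fin.sum_univ_add]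
    simp [hentry, hne, ite_and, mulVec, dotProduct]
  have h2 : ∀ (j : Fin s) (p : Fin q'),
      toEuclideanLin (ampl (q + s) φ (choiMatrix q s)) β (Fin.natAdd q j, p) = 0 := by
    intro j p
    rw [toEuclideanLin_apply_coord]
    simp [hentry, (hne _ _).symm]
  simp only [h1, h2, EuclideanSpace.norm_sq_eq]
  simp

open Matrix in
theorem mul_le_matOpNorm_choiMatrix_sq {q s : ℕ} (hs : 0 < s) :
    (q * s : ℝ) ≤ matOpNorm (choiMatrix q s) ^ 2 := by
  let v : EuclideanSpace ℂ (Fin (q + s) × Fin s) :=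
    WithLp.toLp 2 fun y => if y.1 = Fin.natAdd q y.2 then 1 else 0
  have hv : ‖v‖ ^ 2 = s := by
    rw [EuclideanSpace.norm_sq_eq, Fintype.sum_prod_type, Finset.sum_comm]
    simp [v, apply_ite (norm : ℂ → ℝ), ite_pow]
  have hMv : ‖toEuclideanLin (choiMatrix q s) v‖ ^ 2 = q * (s : ℝ) ^ 2 := by
    have h := norm_sq_ampl_choiMatrix_apply
      (LinearMap.id : Matrix (Fin q) (Fin s) ℂ →ₗ[ℂ] _) v
    have hE : ∀ (i : Fin q) (j : Fin s), toEuclideanLin (single i j (1 : ℂ))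
        (WithLp.toLp 2 fun t => v (Fin.natAdd q j, t)) = EuclideanSpace.single i 1 := by
      intro i j
      ext a
      rw [toEuclideanLin_apply_coord]
      simp [v, single_apply, ite_and, eq_comm]
    refine h.trans ?_
    simp only [LinearMap.id_apply, hE]
    simp [← Nat.cast_smul_eq_nsmul ℂ, norm_smul]
  have h := norm_toEuclideanLin_le_matOpNorm (choiMatrix q s) v
  have h2 : ‖toEuclideanLin (choiMatrix q s) v‖ ^ 2 ≤ (matOpNorm (choiMatrix q s) * ‖v‖) ^ 2 := by
    gcongr
  rw [hMv, mul_pow, hv] at h2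
  have hs' : (0 : ℝ) < s := by exact_mod_cast hs
  nlinarith

theorem sum_norm_sub_smul_sum_sq {E ι : Type*} [NormedAddCommGroup E] [InnerProductSpace ℂ E]
    [Fintype ι] [Nonempty ι] (u : ι → E) :
    ∑ j, ‖u j - ((Fintype.card ι : ℂ)⁻¹) • ∑ l, u l‖ ^ 2 =
      ∑ j, ‖u j‖ ^ 2 - ‖∑ l, u l‖ ^ 2 / Fintype.card ι := by
  set c := ∑ l, u l with hc
  have hcard : (Fintype.card ι : ℝ) ≠ 0 := by exact_mod_cast Fintype.card_ne_zero
  have h1 : ∑ j, RCLike.re (inner ℂ (u j) c) = ‖c‖ ^ 2 := by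
    rw [← map_sum, ← sum_inner, ← hc, inner_self_eq_norm_sq]
  have h2 : ∀ j, ‖u j - ((Fintype.card ι : ℂ)⁻¹) • c‖ ^ 2 =
      ‖u j‖ ^ 2 - 2 * ((Fintype.card ι : ℝ)⁻¹ * RCLike.re (inner ℂ (u j) c)) +
        (Fintype.card ι : ℝ)⁻¹ ^ 2 * ‖c‖ ^ 2 := by
    intro j
    rw [norm_sub_sq (𝕜 := ℂ), inner_smul_right, norm_smul, mul_pow]
    have : ((Fintype.card ι : ℂ)⁻¹) = (((Fintype.card ι : ℝ)⁻¹ : ℝ) : ℂ) := by push_cast; rfl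
    rw [this]
    simp
  simp only [h2, Finset.sum_add_distrib, Finset.sum_sub_distrib, ← Finset.mul_sum, h1,
    Finset.sum_const, Finset.card_univ, nsmul_eq_mul]
  field_simp
  ring

open Matrix in
/-- The Choi matrix detects complete isometries. -/
theorem completelyIsometric_of_matOpNorm_ampl_choiMatrix {q s q' s' : ℕ} (hq : 0 < q)
    (hs : 0 < s) (hs' : 0 < s')
    (φ : Matrix (Fin q) (Fin s) ℂ →ₗ[ℂ] Matrix (Fin q') (Fin s') ℂ)
    (hφ : CompletelyContractive φ)
    (h : matOpNorm (ampl (q + s) φ (choiMatrix q s)) = matOpNorm (choiMatrix q s)) :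
    CompletelyIsometric φ := by
  have : Nonempty (Fin (q + s) × Fin s') := ⟨(⟨0, by omega⟩, ⟨0, hs'⟩)⟩
  have : Nonempty (Fin s) := ⟨⟨0, hs⟩⟩
  have hq0 : (0 : ℝ) < q := by exact_mod_cast hq
  have hs0 : (0 : ℝ) < s := by exact_mod_cast hs
  obtain ⟨β, hβ, hmax⟩ :=
    exists_norm_toEuclideanLin_eq_matOpNorm (ampl (q + s) φ (choiMatrix q s))
  let b : Fin s → EuclideanSpace ℂ (Fin s') := fun j =>
    WithLp.toLp 2 fun t => β (Fin.natAdd q j, t)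
  let u : Fin q → Fin s → EuclideanSpace ℂ (Fin q') := fun i j =>
    toEuclideanLin (φ (single i j 1)) (b j)
  have hlow : (q * s : ℝ) ≤ ∑ i, ‖∑ j, u i j‖ ^ 2 := by
    refine (mul_le_matOpNorm_choiMatrix_sq hs).trans_eq ?_
    rw [← h, ← hmax, norm_sq_ampl_choiMatrix_apply]
  have hbsum : ∑ j, ‖b j‖ ^ 2 ≤ 1 := by
    have h1 : ‖β‖ ^ 2 = 1 := by rw [hβ]; norm_num
    rw [EuclideanSpace.norm_sq_eq, Fintype.sum_prod_type, Fin.sum_univ_add] at h1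
    simp only [b, EuclideanSpace.norm_sq_eq]
    rw [← h1]
    exact le_add_of_nonneg_left (by positivity)
  have hule : ∀ i j, ‖u i j‖ ≤ ‖b j‖ := fun i j => by
    refine (norm_toEuclideanLin_le_matOpNorm _ _).trans ?_
    exact mul_le_of_le_one_left (norm_nonneg _)
      ((hφ.matOpNorm_apply_le _).trans (matOpNorm_single_le_one i j))
  have husq : ∀ i j, ‖u i j‖ ^ 2 ≤ ‖b j‖ ^ 2 := fun i j => by
    gcongr
    exact hule i j
  have hvar : ∑ i, ∑ j, ‖u i j - (s : ℂ)⁻¹ • ∑ l, u i l‖ ^ 2 =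
      ∑ i, ∑ j, ‖u i j‖ ^ 2 - (∑ i, ‖∑ j, u i j‖ ^ 2) / s := by
    rw [Finset.sum_div, ← Finset.sum_sub_distrib]
    refine Finset.sum_congr rfl fun i _ => ?_
    simpa using sum_norm_sub_smul_sum_sq (u i)
  have hup : ∑ i, ∑ j, ‖u i j‖ ^ 2 ≤ ∑ _i : Fin q, ∑ j, ‖b j‖ ^ 2 :=
    Finset.sum_le_sum fun i _ => Finset.sum_le_sum fun j _ => husq i j
  have hup' : ∑ _i : Fin q, ∑ j, ‖b j‖ ^ 2 ≤ q := by
    rw [Finset.sum_const, Finset.card_univ, Fintype.card_fin, nsmul_eq_mul]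
    exact mul_le_of_le_one_right hq0.le hbsum
  have hlow' : (q : ℝ) ≤ (∑ i, ‖∑ j, u i j‖ ^ 2) / s := by
    rwa [le_div_iff₀ hs0]
  have hvarnn : 0 ≤ ∑ i, ∑ j, ‖u i j - (s : ℂ)⁻¹ • ∑ l, u i l‖ ^ 2 := by positivity
  have hvar0 : ∑ i, ∑ j, ‖u i j - (s : ℂ)⁻¹ • ∑ l, u i l‖ ^ 2 = 0 :=
    le_antisymm (by linarith) hvarnn
  have hu : ∀ i j, u i j = (s : ℂ)⁻¹ • ∑ l, u i l := by
    intro i j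
    rw [Finset.sum_eq_zero_iff_of_nonneg fun _ _ => by positivity] at hvar0
    have h1 := hvar0 i (Finset.mem_univ _)
    rw [Finset.sum_eq_zero_iff_of_nonneg fun _ _ => by positivity] at h1
    simpa [sub_eq_zero] using h1 j (Finset.mem_univ _)
  have heq : ∑ i, ∑ j, (‖b j‖ ^ 2 - ‖u i j‖ ^ 2) = 0 := by
    simp only [Finset.sum_sub_distrib]
    linarith
  have hnorm : ∀ i j, ‖b j‖ = ‖u i j‖ := by
    intro i j
    rw [Finset.sum_eq_zero_iff_of_nonneg fun i _ =>
      Finset.sum_nonneg fun j _ => sub_nonneg.2 (husq i j)] at heq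
    have h1 := heq i (Finset.mem_univ _)
    rw [Finset.sum_eq_zero_iff_of_nonneg fun j _ => sub_nonneg.2 (husq i j)] at h1
    have h2 := h1 j (Finset.mem_univ _)
    exact (sq_eq_sq₀ (norm_nonneg _) (norm_nonneg _)).1 (sub_eq_zero.1 h2)
  let i₀ : Fin q := ⟨0, hq⟩
  let j₀ : Fin s := ⟨0, hs⟩
  have hbr : ∀ j, ‖b j‖ = ‖b j₀‖ := fun j => by
    rw [hnorm i₀ j, hnorm i₀ j₀, hu i₀ j, hu i₀ j₀]
  have hur : ∀ i j, u i j = u i j₀ := fun i j => by rw [hu i j, hu i j₀]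
  have hr : ‖b j₀‖ ≠ 0 := by
    intro h0
    have : ∑ i : Fin q, ∑ j, ‖u i j‖ ^ 2 = 0 := by
      simp [← hnorm, hbr, h0]
    linarith
  refine completelyIsometric_of_vectors hq hs φ hφ (fun i => ((‖b j₀‖⁻¹ : ℝ) : ℂ) • u i j₀)
    (fun j => ((‖b j₀‖⁻¹ : ℝ) : ℂ) • b j) ?_ ?_ ?_
  · intro i
    simp [norm_smul, ← hnorm, hr]
  · intro j
    simp [norm_smul, hbr j, hr]
  · intro i j
    rw [map_smul, ← hur i j]

/-- Let `φ i : M_{q,s} → M_{q_i,s_i}` be completely contractive linear maps and let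
`φ : M_{q,s} → M_{q₁,s₁} ⊕_∞ ⋯ ⊕_∞ M_{q_N,s_N}`, `x ↦ (φ₁ x, …, φ_N x)`. Since the matrix
norms of the `∞`-sum are the maxima of the blockwise norms, `φ` is completely isometric
(i.e. `⨆ i, ‖(φ i)⁽ⁿ⁾ M‖ = ‖M‖` for all `n`, `M`) iff some `φ i` is completely isometric. -/
theorem completelyIsometric_into_inftySum_iff
    (q s N : ℕ) (hq : 0 < q) (hs : 0 < s) (hN : 0 < N)
    (qd sd : Fin N → ℕ) (hqd : ∀ i, 0 < qd i) (hsd : ∀ i, 0 < sd i)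
    (φ : ∀ i : Fin N, Matrix (Fin q) (Fin s) ℂ →ₗ[ℂ] Matrix (Fin (qd i)) (Fin (sd i)) ℂ)
    (hφ : ∀ i, CompletelyContractive (⇑(φ i))) :
    (∀ (n : ℕ) (M : Matrix (Fin n × Fin q) (Fin n × Fin s) ℂ),
        (⨆ i : Fin N, matOpNorm (ampl n (⇑(φ i)) M)) = matOpNorm M) ↔
      ∃ i, CompletelyIsometric (⇑(φ i)) := by
  have : Nonempty (Fin N) := ⟨⟨0, hN⟩⟩
  constructor
  · intro h
    obtain ⟨i, hi⟩ := exists_eq_ciSup_of_finite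
      (f := fun i : Fin N => matOpNorm (ampl (q + s) (⇑(φ i)) (choiMatrix q s)))
    exact ⟨i, completelyIsometric_of_matOpNorm_ampl_choiMatrix hq hs (hsd i) (φ i) (hφ i)
      (hi.trans (h _ _))⟩
  · rintro ⟨i, hi⟩ n M
    refine le_antisymm (ciSup_le fun j => hφ j n M) ?_
    rw [← hi n M]
    exact le_ciSup (f := fun i => matOpNorm (ampl n (⇑(φ i)) M)) (Set.finite_range _).bddAbove i
end
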